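/- Suppose p(s) = α₁ s + α₀ is an affine polynomial and 1/2 ≤ |γ| ≤ Γ. Then there is a constant C_Γ, depending only on Γ and η₀, such that for every finite set I of pairs (j₁,j₂) ∈ ℤ² with j₁ ≥ 10 and every f ∈ C_c^∞(ℝ²), the operator 𝒯f(x) = Σ_{j∈I} ∫_{ℝ²} T_j(x,y) f(y) dy satisfies ‖𝒯f‖_{L²(ℝ²)} ≤ C_Γ · ‖f‖_{L²(ℝ²)}; the bound is independent of I, of α₀ and α₁, and of γ. -/

import Mathlib

/- STATEMENT 7: uniform L² bound for 𝒯 when p is affine. -/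

open MeasureTheory Polynomial

noncomputable section

/-- `β(t) = (1 + t²/4)^(1/2)`. -/
def bet (t : ℝ) : ℝ := Real.sqrt (1 + t ^ 2 / 4)

/-- The phase `Ψ(x,y) = (x₁−y₁)(x₂²+y₂²) − (x₂−y₂)·p(x₁+y₁)`. -/
def Psi (p : Polynomial ℝ) (x y : ℝ × ℝ) : ℝ :=
  (x.1 - y.1) * (x.2 ^ 2 + y.2 ^ 2) - (x.2 - y.2) * p.eval (x.1 + y.1)

/-- `θ(x,y) = β(x₁−y₁)·|x₂+y₂+p′(x₁+y₁)|·(x₂−y₂)`. -/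
def theta (p : Polynomial ℝ) (x y : ℝ × ℝ) : ℝ :=
  bet (x.1 - y.1) * |x.2 + y.2 + p.derivative.eval (x.1 + y.1)| * (x.2 - y.2)

/-- `sin θ(x,y)/(x₂−y₂)`, extended continuously across `x₂ = y₂`. -/
def sinq (p : Polynomial ℝ) (x y : ℝ × ℝ) : ℝ :=
  if x.2 = y.2 then bet (x.1 - y.1) * |x.2 + y.2 + p.derivative.eval (x.1 + y.1)|
  else Real.sin (theta p x y) / (x.2 - y.2)

/-- `g` has only finitely many sign changes: there is a uniform bound `N` on the length of
increasing chains of points at which `g` changes sign between consecutive points. -/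
def FinSignChanges (g : ℝ → ℝ) : Prop :=
  ∃ N : ℕ, ∀ s : ℕ → ℝ, StrictMono s →
    ∀ m : ℕ, (∀ i < m, g (s i) * g (s (i + 1)) < 0) → m ≤ N

/-- The standing hypotheses on the cut-off function `η₀`: smooth, even, `[0,1]`-valued,
`≡ 1` on `{|s| ≤ 1/2}`, `≡ 0` on `{|s| ≥ 3/4}`, and `η₀′` has finitely many sign changes. -/
structure CutoffFun (η₀ : ℝ → ℝ) : Prop where
  smooth : ContDiff ℝ (⊤ : ℕ∞) η₀
  even : ∀ s, η₀ (-s) = η₀ s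
  mem01 : ∀ s, η₀ s ∈ Set.Icc (0 : ℝ) 1
  eq_one : ∀ s, |s| ≤ 1 / 2 → η₀ s = 1
  eq_zero : ∀ s, 3 / 4 ≤ |s| → η₀ s = 0
  signChanges : FinSignChanges (deriv η₀)

/-- `η(s) = η₀(s/2) − η₀(s)`. -/
def etad (η₀ : ℝ → ℝ) (s : ℝ) : ℝ := η₀ (s / 2) - η₀ s

/-- `χ_{1,j₁}(s) = 2^{j₁}·η(2^{−j₁}s)/β(s)`. -/
def chi1 (η₀ : ℝ → ℝ) (j₁ : ℤ) (s : ℝ) : ℝ :=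
  (2 : ℝ) ^ j₁ * etad η₀ ((2 : ℝ) ^ (-j₁) * s) / bet s

/-- `χ_{2,j₂}(s) = 2^{j₂}·η(2^{−j₂}s)/s`. -/
def chi2 (η₀ : ℝ → ℝ) (j₂ : ℤ) (s : ℝ) : ℝ :=
  (2 : ℝ) ^ j₂ * etad η₀ ((2 : ℝ) ^ (-j₂) * s) / s

/-- The kernel `T_j(x,y) = 2^{−j₁−j₂}·χ_j(x−y)·e^{iγΨ(x,y)}·sin θ(x,y)`. -/
def Tker (η₀ : ℝ → ℝ) (p : Polynomial ℝ) (γ : ℝ) (j : ℤ × ℤ) (x y : ℝ × ℝ) : ℂ :=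
  ((2 : ℝ) ^ (-j.1 - j.2) * chi1 η₀ j.1 (x.1 - y.1) * chi2 η₀ j.2 (x.2 - y.2) *
      Real.sin (theta p x y) : ℝ) * Complex.exp (Complex.I * (γ * Psi p x y : ℝ))

open FourierTransform in
/-- Plancherel's identity for functions in `L¹ ∩ L²`. -/
theorem lintegral_enorm_sq_fourier {g : ℝ → ℂ} (h1 : Integrable g) (h2 : MemLp g 2) :
    ∫⁻ ξ, ‖𝓕 g ξ‖ₑ ^ 2 = ∫⁻ x, ‖g x‖ₑ ^ 2 := by
  have hcont : Continuous (𝓕 g) := by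
    simpa using! VectorFourier.fourierIntegral_continuous Real.continuous_fourierChar
      (L := innerₗ ℝ) continuous_inner h1
  have hae : ∀ᵐ ξ, (𝓕 (h2.toLp g) : Lp ℂ 2 volume) ξ = 𝓕 g ξ := by
    refine ae_eq_of_integral_contDiff_smul_eq
      ((Lp.memLp _).locallyIntegrable (by norm_num)) hcont.locallyIntegrable ?_
    intro φ hφ hφc
    have hc : HasCompactSupport (fun x => (φ x : ℂ)) := by
      exact hφc.comp_left (g := fun t : ℝ => (t : ℂ)) (by simp)
    let Φ : SchwartzMap ℝ ℂ := hc.toSchwartzMap (Complex.ofRealCLM.contDiff.comp hφ)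
    have hΦ : ∀ x, Φ x = (φ x : ℂ) := fun x => rfl
    have e1 := congrArg (fun T : TemperedDistribution ℝ ℂ => T Φ)
      (Lp.fourier_toTemperedDistribution_eq (h2.toLp g))
    simp only [TemperedDistribution.fourier_apply, Lp.toTemperedDistribution_apply] at e1
    have e2 : ∫ ξ, φ ξ • 𝓕 g ξ = ∫ x, 𝓕 Φ x • g x := by
      have := VectorFourier.integral_bilin_fourierIntegral_eq_flip
        (ContinuousLinearMap.mul ℂ ℂ) (L := innerₗ ℝ) (μ := volume) (ν := volume)
        Real.continuous_fourierChar continuous_inner h1 Φ.integrable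
      simp only [ContinuousLinearMap.mul_apply', flip_innerₗ] at this
      calc ∫ ξ, φ ξ • 𝓕 g ξ = ∫ ξ, 𝓕 g ξ * Φ ξ := by
            congr with ξ; rw [hΦ, Complex.real_smul, mul_comm]
        _ = ∫ x, g x * 𝓕 Φ x := this
        _ = _ := by congr with ξ; rw [smul_eq_mul, mul_comm]
    rw [e2]
    calc _ = ∫ x, Φ x • (𝓕 (h2.toLp g) : Lp ℂ 2 volume) x := by
          congr with x
      _ = _ := e1.symm
      _ = _ := by
          apply integral_congr_ae
          filter_upwards [h2.coeFn_toLp] with x hx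
          rw [hx]
  have key : eLpNorm (𝓕 g) 2 volume = eLpNorm g 2 volume := by
    rw [← eLpNorm_congr_ae hae, ← eLpNorm_congr_ae h2.coeFn_toLp, ← Lp.enorm_def, ← Lp.enorm_def,
      ← ofReal_norm, ← ofReal_norm, Lp.norm_fourier_eq]
  have e : ∀ h : ℝ → ℂ, eLpNorm h 2 volume ^ 2 = ∫⁻ x, ‖h x‖ₑ ^ 2 := by
    intro h
    have := eLpNorm_nnreal_pow_eq_lintegral (f := h) (μ := volume) (p := 2) (by norm_num : (2:NNReal) ≠ 0)
    simpa using this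
  rw [← e, ← e, key]

theorem ENNReal.sq_lintegral_mul_le {α : Type*} [MeasurableSpace α] {μ : Measure α}
    {a b : α → ENNReal} (ha : AEMeasurable a μ) (hb : AEMeasurable b μ) :
    (∫⁻ x, a x * b x ∂μ) ^ 2 ≤ (∫⁻ x, a x ^ 2 ∂μ) * ∫⁻ x, b x ^ 2 ∂μ := by
  have h := ENNReal.lintegral_mul_le_Lp_mul_Lq μ Real.HolderConjugate.two_two ha hb
  simp only [Pi.mul_apply, ENNReal.rpow_two] at h
  calc _ ≤ ((∫⁻ x, a x ^ 2 ∂μ) ^ (1 / 2 : ℝ) * (∫⁻ x, b x ^ 2 ∂μ) ^ (1 / 2 : ℝ)) ^ 2 := by gcongr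
    _ = _ := by
      rw [mul_pow, ← ENNReal.rpow_mul_natCast, ← ENNReal.rpow_mul_natCast]
      norm_num

/-- Schur's test with a weight. -/
theorem lintegral_sq_lintegral_le_of_schur {K : ℝ → ℝ → ENNReal}
    (hK : Measurable (Function.uncurry K)) {w : ℝ → ENNReal} (hw : Measurable w)
    (hw0 : ∀ᵐ x, w x ≠ 0) (hwt : ∀ x, w x ≠ ⊤) {C : ENNReal}
    (h1 : ∀ᵐ x, ∫⁻ y, K x y * w y ≤ C * w x)
    (h2 : ∀ᵐ y, ∫⁻ x, K x y * w x ≤ C * w y) {f : ℝ → ENNReal} (hf : Measurable f) :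
    ∫⁻ x, (∫⁻ y, K x y * f y) ^ 2 ≤ C ^ 2 * ∫⁻ y, f y ^ 2 := by
  have hK1 : ∀ x, Measurable (K x) := fun x => hK.comp measurable_prodMk_left
  have hK2 : ∀ y, Measurable (fun x => K x y) := fun y => hK.comp measurable_prodMk_right
  have step : ∀ᵐ x, (∫⁻ y, K x y * f y) ^ 2 ≤ C * w x * ∫⁻ y, K x y * (f y ^ 2 * (w y)⁻¹) := by
    filter_upwards [h1] with x hx
    have e : ∫⁻ y, K x y * f y = ∫⁻ y, (K x y * w y) ^ (1 / 2 : ℝ) *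
        (K x y * (f y ^ 2 * (w y)⁻¹)) ^ (1 / 2 : ℝ) := by
      apply lintegral_congr_ae
      filter_upwards [hw0] with y hy
      rw [← ENNReal.mul_rpow_of_nonneg _ _ (by norm_num)]
      have : K x y * w y * (K x y * (f y ^ 2 * (w y)⁻¹)) = (K x y * f y) ^ 2 := by
        calc _ = (K x y * f y) ^ 2 * (w y * (w y)⁻¹) := by ring
          _ = _ := by rw [ENNReal.mul_inv_cancel hy (hwt y), mul_one]
      rw [this, ← ENNReal.rpow_natCast_mul]
      norm_num
    rw [e]
    refine (ENNReal.sq_lintegral_mul_le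
      (((hK1 x).mul hw).pow_const _).aemeasurable
      (((hK1 x).mul ((hf.pow_const 2).mul hw.inv)).pow_const _).aemeasurable).trans ?_
    have e2 : ∀ t : ENNReal, (t ^ (1 / 2 : ℝ)) ^ 2 = t := by
      intro t
      rw [← ENNReal.rpow_mul_natCast]; norm_num
    simp only [e2]
    exact mul_le_mul' hx le_rfl
  calc _ ≤ ∫⁻ x, C * w x * ∫⁻ y, K x y * (f y ^ 2 * (w y)⁻¹) := lintegral_mono_ae step
    _ = ∫⁻ x, ∫⁻ y, C * w x * (K x y * (f y ^ 2 * (w y)⁻¹)) := by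
      congr with x
      rw [lintegral_const_mul]
      exact (hK1 x).mul ((hf.pow_const 2).mul hw.inv)
    _ = ∫⁻ y, ∫⁻ x, C * w x * (K x y * (f y ^ 2 * (w y)⁻¹)) := by
      apply lintegral_lintegral_swap
      apply Measurable.aemeasurable
      have : Measurable (fun p : ℝ × ℝ => C * w p.1 * (K p.1 p.2 * (f p.2 ^ 2 * (w p.2)⁻¹))) := by
        have h : Measurable (fun p : ℝ × ℝ => K p.1 p.2) := hK
        fun_prop
      exact this
    _ = ∫⁻ y, C * (f y ^ 2 * (w y)⁻¹) * ∫⁻ x, K x y * w x := by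
      congr with y
      have m : Measurable (fun x => K x y * w x) := (hK2 y).mul hw
      rw [← lintegral_const_mul _ m]
      congr with x
      ring
    _ ≤ ∫⁻ y, C ^ 2 * f y ^ 2 := by
      apply lintegral_mono_ae
      filter_upwards [h2, hw0] with y hy hy0
      calc _ ≤ C * (f y ^ 2 * (w y)⁻¹) * (C * w y) := by gcongr
        _ = C ^ 2 * f y ^ 2 * (w y * (w y)⁻¹) := by ring
        _ = _ := by rw [ENNReal.mul_inv_cancel hy0 (hwt y), mul_one]
    _ = _ := by rw [lintegral_const_mul _ (hf.pow_const 2)]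

theorem lintegral_Ioi_rpow_div_add_le {v : ℝ} (hv : 0 < v) :
    ∫⁻ u in Set.Ioi (0 : ℝ), ENNReal.ofReal (1 / (v + u) * u ^ (-1 / 2 : ℝ)) ≤
      ENNReal.ofReal (4 * v ^ (-1 / 2 : ℝ)) := by
  have hsplit : Set.Ioi (0 : ℝ) = Set.Ioc 0 v ∪ Set.Ioi v := (Set.Ioc_union_Ioi_eq_Ioi hv.le).symm
  have i1 : IntegrableOn (fun u : ℝ => v⁻¹ * u ^ (-1 / 2 : ℝ)) (Set.Ioc 0 v) := by
    have := (intervalIntegral.intervalIntegrable_rpow' (a := 0) (b := v)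
      (by norm_num : (-1 : ℝ) < -1 / 2)).const_mul v⁻¹
    exact (intervalIntegrable_iff_integrableOn_Ioc_of_le hv.le).1 this
  have i2 : IntegrableOn (fun u : ℝ => u ^ (-3 / 2 : ℝ)) (Set.Ioi v) :=
    integrableOn_Ioi_rpow_of_lt (by norm_num) hv
  have vv : v⁻¹ * v ^ (1 / 2 : ℝ) = v ^ (-1 / 2 : ℝ) := by
    rw [← Real.rpow_neg_one, ← Real.rpow_add hv]; norm_num
  have b1 : ∫⁻ u in Set.Ioc (0 : ℝ) v, ENNReal.ofReal (1 / (v + u) * u ^ (-1 / 2 : ℝ)) ≤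
      ENNReal.ofReal (2 * v ^ (-1 / 2 : ℝ)) := by
    calc _ ≤ ∫⁻ u in Set.Ioc (0 : ℝ) v, ENNReal.ofReal (v⁻¹ * u ^ (-1 / 2 : ℝ)) := by
          apply setLIntegral_mono' measurableSet_Ioc
          intro u hu
          apply ENNReal.ofReal_le_ofReal
          have := Real.rpow_nonneg hu.1.le (-1 / 2)
          gcongr
          rw [one_div]
          gcongr
          linarith [hu.1]
      _ = ENNReal.ofReal (∫ u in Set.Ioc (0 : ℝ) v, v⁻¹ * u ^ (-1 / 2 : ℝ)) := by
          rw [ofReal_integral_eq_lintegral_ofReal i1]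
          filter_upwards [ae_restrict_mem measurableSet_Ioc] with u hu
          have := Real.rpow_nonneg hu.1.le (-1 / 2)
          have := inv_pos.2 hv
          simp only [Pi.zero_apply]
          positivity
      _ = _ := by
          congr 1
          rw [← intervalIntegral.integral_of_le hv.le, intervalIntegral.integral_const_mul,
            integral_rpow (Or.inl (by norm_num)), ← vv]
          norm_num
          ring
  have b2 : ∫⁻ u in Set.Ioi v, ENNReal.ofReal (1 / (v + u) * u ^ (-1 / 2 : ℝ)) ≤
      ENNReal.ofReal (2 * v ^ (-1 / 2 : ℝ)) := by
    calc _ ≤ ∫⁻ u in Set.Ioi v, ENNReal.ofReal (u ^ (-3 / 2 : ℝ)) := by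
          apply setLIntegral_mono' measurableSet_Ioi
          intro u hu
          have hu0 : 0 < u := hv.trans hu
          apply ENNReal.ofReal_le_ofReal
          have e : u ^ (-3 / 2 : ℝ) = u⁻¹ * u ^ (-1 / 2 : ℝ) := by
            rw [← Real.rpow_neg_one, ← Real.rpow_add hu0]; norm_num
          have := Real.rpow_nonneg hu0.le (-1 / 2)
          rw [e, one_div]
          gcongr
          linarith
      _ = ENNReal.ofReal (∫ u in Set.Ioi v, u ^ (-3 / 2 : ℝ)) := by
          rw [ofReal_integral_eq_lintegral_ofReal i2]
          filter_upwards [ae_restrict_mem measurableSet_Ioi] with u hu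
          exact Real.rpow_nonneg (hv.trans hu).le _
      _ = _ := by
          congr 1
          rw [integral_Ioi_rpow_of_lt (by norm_num) hv]
          norm_num
          ring
  rw [hsplit]
  calc _ ≤ _ := lintegral_union_le _ _ _
    _ ≤ _ := add_le_add b1 b2
    _ = _ := by
      rw [← ENNReal.ofReal_add (by positivity) (by positivity)]
      congr 1; ring

/-- A Hilbert-type kernel, singular at the points `±x₀`. -/
def hilbertKernel (x₀ x y : ℝ) : ℝ := 1 / (|(|x| - x₀)| + |(|y| - x₀)|)

theorem lintegral_hilbertKernel_mul_le {x₀ x : ℝ} (hx : |x| ≠ x₀) :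
    ∫⁻ y, ENNReal.ofReal (hilbertKernel x₀ x y) * ENNReal.ofReal (|(|y| - x₀)| ^ (-1 / 2 : ℝ)) ≤
      16 * ENNReal.ofReal (|(|x| - x₀)| ^ (-1 / 2 : ℝ)) := by
  set v := |(|x| - x₀)| with hv
  have hv0 : 0 < v := abs_pos.2 (sub_ne_zero.2 hx)
  set g₁ : ℝ → ENNReal := fun u => (Set.Ioi (0 : ℝ)).indicator
    (fun u => ENNReal.ofReal (1 / (v + u) * u ^ (-1 / 2 : ℝ))) u with hg₁
  have hg₁m : Measurable g₁ := by
    apply Measurable.indicator _ measurableSet_Ioi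
    fun_prop
  set g : ℝ → ENNReal := fun u => ENNReal.ofReal (1 / (v + |u|) * |u| ^ (-1 / 2 : ℝ)) with hg
  have hgm : Measurable g := by fun_prop
  have gle : ∀ u, g u ≤ g₁ u + g₁ (-u) := by
    intro u
    rcases lt_trichotomy u 0 with h | h | h
    · refine le_trans (le_of_eq ?_) le_add_self
      simp [hg, hg₁, h, abs_of_neg h]
    · subst h
      simp [hg]
    · refine le_trans (le_of_eq ?_) le_self_add
      simp [hg, hg₁, h, abs_of_pos h]
  have hg₁i : ∫⁻ u, g₁ u ≤ ENNReal.ofReal (4 * v ^ (-1 / 2 : ℝ)) := by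
    rw [hg₁, lintegral_indicator measurableSet_Ioi]
    exact lintegral_Ioi_rpow_div_add_le hv0
  have hgi : ∫⁻ u, g u ≤ 2 * ENNReal.ofReal (4 * v ^ (-1 / 2 : ℝ)) := by
    calc _ ≤ ∫⁻ u, (g₁ u + g₁ (-u)) := lintegral_mono gle
      _ = (∫⁻ u, g₁ u) + ∫⁻ u, g₁ (-u) := lintegral_add_left hg₁m _
      _ = 2 * ∫⁻ u, g₁ u := by rw [lintegral_neg_eq_self, two_mul]
      _ ≤ _ := by gcongr
  calc _ ≤ ∫⁻ y, (g (y - x₀) + g (-y - x₀)) := by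
        apply lintegral_mono
        intro y
        have : ENNReal.ofReal (hilbertKernel x₀ x y) *
            ENNReal.ofReal (|(|y| - x₀)| ^ (-1 / 2 : ℝ)) = g (|y| - x₀) := by
          rw [← ENNReal.ofReal_mul (by unfold hilbertKernel; positivity)]
          rfl
        simp only [this]
        rcases abs_choice y with h | h <;> rw [h]
        · exact le_self_add
        · exact le_add_self
    _ = (∫⁻ y, g (y - x₀)) + ∫⁻ y, g (-y - x₀) := lintegral_add_left (by fun_prop) _
    _ = 2 * ∫⁻ y, g y := by
      rw [lintegral_neg_eq_self (f := fun y => g (y - x₀)), lintegral_sub_right_eq_self g, two_mul]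
    _ ≤ 2 * (2 * ENNReal.ofReal (4 * v ^ (-1 / 2 : ℝ))) := by gcongr
    _ = _ := by
      rw [ENNReal.ofReal_mul (by norm_num)]
      norm_num [← mul_assoc]

theorem lintegral_sq_lintegral_hilbertKernel_le (x₀ : ℝ) {f : ℝ → ENNReal} (hf : Measurable f) :
    ∫⁻ x, (∫⁻ y, ENNReal.ofReal (hilbertKernel x₀ x y) * f y) ^ 2 ≤ 16 ^ 2 * ∫⁻ y, f y ^ 2 := by
  have hae : ∀ᵐ x : ℝ, |x| ≠ x₀ := by
    have : ({x₀, -x₀} : Set ℝ)ᶜ ∈ ae (volume : Measure ℝ) :=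
      compl_mem_ae_iff.2 ((Set.toFinite _).measure_zero _)
    filter_upwards [this] with x hx h
    apply hx
    rcases abs_choice x with h' | h' <;> rw [h'] at h
    · simp [h]
    · simp [← h]
  have hsymm : ∀ x y, hilbertKernel x₀ x y = hilbertKernel x₀ y x := by
    intro x y; unfold hilbertKernel; rw [add_comm]
  refine lintegral_sq_lintegral_le_of_schur
    (w := fun x => ENNReal.ofReal (|(|x| - x₀)| ^ (-1 / 2 : ℝ))) ?_ (by fun_prop) ?_
    (fun x => ENNReal.ofReal_ne_top) ?_ ?_ hf
  · have : Measurable (fun p : ℝ × ℝ => ENNReal.ofReal (hilbertKernel x₀ p.1 p.2)) := by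
      unfold hilbertKernel; fun_prop
    exact this
  · filter_upwards [hae] with x hx
    have : 0 < |(|x| - x₀)| := abs_pos.2 (sub_ne_zero.2 hx)
    simpa using Real.rpow_pos_of_pos this _
  · filter_upwards [hae] with x hx
    exact lintegral_hilbertKernel_mul_le hx
  · filter_upwards [hae] with y hy
    simp only [hsymm _ y]
    exact lintegral_hilbertKernel_mul_le hy

theorem exists_sum_min_zpow_le : ∃ C : ℝ, 0 < C ∧ ∀ σ : ℤ → ℤ, Function.Injective σ →
    ∀ t : ℝ, 0 ≤ t → ∀ J : Finset ℤ,
      ∑ j ∈ J, min ((2 : ℝ) ^ σ j * t) ((2 : ℝ) ^ σ j * t)⁻¹ ≤ C := by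
  have hs : Summable (fun n : ℤ => 2 * (1 / 2 : ℝ) ^ n.natAbs) := by
    apply Summable.mul_left
    rw [summable_int_iff_summable_nat_and_neg]
    constructor <;>
    · simp only [Int.natAbs_neg, Int.natAbs_natCast]
      exact summable_geometric_of_lt_one (by norm_num) (by norm_num)
  refine ⟨∑' n : ℤ, 2 * (1 / 2 : ℝ) ^ n.natAbs,
    hs.tsum_pos (fun n => by positivity) 0 (by norm_num), ?_⟩
  intro σ hσ t ht J
  rcases ht.eq_or_lt with rfl | ht
  · simpa using tsum_nonneg (fun n : ℤ => by positivity)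
  obtain ⟨k, hk1, hk2⟩ := exists_mem_Ico_zpow ht (one_lt_two)
  have hinj : Function.Injective (fun j => σ j + k) := fun a b h => hσ (add_right_cancel h)
  calc _ ≤ ∑ j ∈ J, 2 * (1 / 2 : ℝ) ^ (σ j + k).natAbs := by
        apply Finset.sum_le_sum
        intro j _
        rcases le_or_gt 0 (σ j + k) with h | h
        · refine (min_le_right _ _).trans ?_
          have e : (1 / 2 : ℝ) ^ (σ j + k).natAbs = ((2 : ℝ) ^ σ j * 2 ^ k)⁻¹ := by
            rw [← zpow_add₀ two_ne_zero, ← zpow_natCast, Int.natAbs_of_nonneg h, one_div, inv_zpow]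
          rw [e]
          have : ((2 : ℝ) ^ σ j * t)⁻¹ ≤ ((2 : ℝ) ^ σ j * 2 ^ k)⁻¹ := by gcongr
          have : 0 ≤ ((2 : ℝ) ^ σ j * 2 ^ k)⁻¹ := by positivity
          linarith
        · refine (min_le_left _ _).trans ?_
          have e : (1 / 2 : ℝ) ^ (σ j + k).natAbs = (2 : ℝ) ^ σ j * 2 ^ k := by
            rw [← zpow_add₀ two_ne_zero, ← zpow_natCast, Int.ofNat_natAbs_of_nonpos h.le, one_div,
              inv_zpow, zpow_neg, inv_inv]
          rw [e]
          rw [zpow_add_one₀ two_ne_zero] at hk2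
          have : (2 : ℝ) ^ σ j * t ≤ (2 : ℝ) ^ σ j * (2 ^ k * 2) := by gcongr
          linarith
    _ = ∑ n ∈ J.map ⟨_, hinj⟩, 2 * (1 / 2 : ℝ) ^ n.natAbs := by simp
    _ ≤ _ := hs.sum_le_tsum _ (fun n _ => by positivity)

/-- Integration by parts for an oscillatory integral whose phase has no critical point. -/
theorem integral_mul_cexp_eq {a b : ℝ} (hab : a ≤ b) {F F₁ φ φ₁ φ₂ : ℝ → ℝ}
    (hF : ∀ t ∈ Set.Icc a b, HasDerivAt F (F₁ t) t)
    (hφ : ∀ t ∈ Set.Icc a b, HasDerivAt φ (φ₁ t) t)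
    (hφ₁ : ∀ t ∈ Set.Icc a b, HasDerivAt φ₁ (φ₂ t) t)
    (hF₁ : ContinuousOn F₁ (Set.Icc a b)) (hφ₂ : ContinuousOn φ₂ (Set.Icc a b))
    (h0 : ∀ t ∈ Set.Icc a b, φ₁ t ≠ 0) (ha : F a = 0) (hb : F b = 0) :
    ∫ t in a..b, (F t : ℂ) * Complex.exp (Complex.I * (φ t : ℝ)) =
      Complex.I * ∫ t in a..b, ((F₁ t / φ₁ t - F t * φ₂ t / φ₁ t ^ 2 : ℝ) : ℂ) *
        Complex.exp (Complex.I * (φ t : ℝ)) := by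
  have cF : ContinuousOn F (Set.Icc a b) := fun t ht => (hF t ht).continuousAt.continuousWithinAt
  have cφ : ContinuousOn φ (Set.Icc a b) := fun t ht => (hφ t ht).continuousAt.continuousWithinAt
  have cφ₁ : ContinuousOn φ₁ (Set.Icc a b) :=
    fun t ht => (hφ₁ t ht).continuousAt.continuousWithinAt
  have cE : ContinuousOn (fun t => Complex.exp (Complex.I * (φ t : ℝ))) (Set.Icc a b) := by fun_prop
  have cG : ContinuousOn (fun t => F₁ t / φ₁ t - F t * φ₂ t / φ₁ t ^ 2) (Set.Icc a b) :=
    (hF₁.div cφ₁ h0).sub ((cF.mul hφ₂).div (cφ₁.pow 2) (fun t ht => pow_ne_zero 2 (h0 t ht)))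
  have i1 : IntervalIntegrable (fun t => (F t : ℂ) * Complex.exp (Complex.I * (φ t : ℝ)))
      volume a b := by
    apply ContinuousOn.intervalIntegrable
    rw [Set.uIcc_of_le hab]
    exact (Complex.continuous_ofReal.comp_continuousOn cF).mul cE
  have i2 : IntervalIntegrable (fun t => ((F₁ t / φ₁ t - F t * φ₂ t / φ₁ t ^ 2 : ℝ) : ℂ) *
        Complex.exp (Complex.I * (φ t : ℝ))) volume a b := by
    apply ContinuousOn.intervalIntegrable
    rw [Set.uIcc_of_le hab]
    exact (Complex.continuous_ofReal.comp_continuousOn cG).mul cE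
  have key : ∫ t in a..b, (((F₁ t / φ₁ t - F t * φ₂ t / φ₁ t ^ 2 : ℝ) : ℂ) *
        Complex.exp (Complex.I * (φ t : ℝ)) +
        Complex.I * ((F t : ℂ) * Complex.exp (Complex.I * (φ t : ℝ)))) = 0 := by
    rw [intervalIntegral.integral_eq_sub_of_hasDerivAt
      (f := fun t => ((F t / φ₁ t : ℝ) : ℂ) * Complex.exp (Complex.I * (φ t : ℝ)))]
    · simp [ha, hb]
    · intro t ht
      rw [Set.uIcc_of_le hab] at ht
      have d1 := ((hF t ht).div (hφ₁ t ht) (h0 t ht)).ofReal_comp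
      have d2 := (((hφ t ht).ofReal_comp).const_mul Complex.I).cexp
      refine (d1.mul d2).congr_deriv ?_
      have : (φ₁ t : ℂ) ≠ 0 := by exact_mod_cast h0 t ht
      push_cast
      simp only [Pi.div_apply]
      push_cast
      field_simp
    · exact i2.add (i1.const_mul _)
  rw [intervalIntegral.integral_add i2 (i1.const_mul _), intervalIntegral.integral_const_mul] at key
  linear_combination (-Complex.I) * key +
    (∫ t in a..b, (F t : ℂ) * Complex.exp (Complex.I * (φ t : ℝ))) *
    Complex.I_sq

theorem norm_integral_mul_cexp_le_const {F φ : ℝ → ℝ} {c : ℝ}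
    (h : ∀ t ∈ Set.Icc (1 / 2 : ℝ) (3 / 2), |F t| ≤ c) :
    ‖∫ t in (1 / 2 : ℝ)..(3 / 2), (F t : ℂ) * Complex.exp (Complex.I * (φ t : ℝ))‖ ≤ c := by
  have := intervalIntegral.norm_integral_le_of_norm_le_const (a := (1 / 2 : ℝ)) (b := 3 / 2) (C := c)
    (f := fun t => (F t : ℂ) * Complex.exp (Complex.I * (φ t : ℝ))) ?_
  · norm_num at this ⊢; exact this
  · intro t ht
    rw [Set.uIoc_of_le (by norm_num)] at ht
    rw [norm_mul, mul_comm Complex.I, Complex.norm_exp_ofReal_mul_I, mul_one, Complex.norm_real]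
    exact h t ⟨ht.1.le, ht.2⟩

theorem norm_integral_mul_cexp_le_of_deriv {F F₁ φ φ₁ φ₂ : ℝ → ℝ} {a₀ a₁ ρ d : ℝ}
    (hF : ∀ t ∈ Set.Icc (1 / 2 : ℝ) (3 / 2), HasDerivAt F (F₁ t) t)
    (hφ : ∀ t ∈ Set.Icc (1 / 2 : ℝ) (3 / 2), HasDerivAt φ (φ₁ t) t)
    (hφ₁ : ∀ t ∈ Set.Icc (1 / 2 : ℝ) (3 / 2), HasDerivAt φ₁ (φ₂ t) t)
    (hF₁ : ContinuousOn F₁ (Set.Icc (1 / 2 : ℝ) (3 / 2)))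
    (hφ₂ : ContinuousOn φ₂ (Set.Icc (1 / 2 : ℝ) (3 / 2)))
    (ha : F (1 / 2) = 0) (hb : F (3 / 2) = 0) (hρ : 0 < ρ)
    (b0 : ∀ t ∈ Set.Icc (1 / 2 : ℝ) (3 / 2), |F t| ≤ a₀)
    (b1 : ∀ t ∈ Set.Icc (1 / 2 : ℝ) (3 / 2), |F₁ t| ≤ a₁)
    (c1 : ∀ t ∈ Set.Icc (1 / 2 : ℝ) (3 / 2), ρ ≤ |φ₁ t|)
    (c2 : ∀ t ∈ Set.Icc (1 / 2 : ℝ) (3 / 2), |φ₂ t| ≤ d) :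
    ‖∫ t in (1 / 2 : ℝ)..(3 / 2), (F t : ℂ) * Complex.exp (Complex.I * (φ t : ℝ))‖ ≤
      a₁ / ρ + a₀ * d / ρ ^ 2 := by
  rw [integral_mul_cexp_eq (by norm_num) hF hφ hφ₁ hF₁ hφ₂
    (fun t ht => abs_pos.1 (hρ.trans_le (c1 t ht))) ha hb, norm_mul, Complex.norm_I, one_mul]
  apply norm_integral_mul_cexp_le_const
  intro t ht
  have ha₀ := (abs_nonneg _).trans (b0 t ht)
  have ha₁ := (abs_nonneg _).trans (b1 t ht)
  have hd := (abs_nonneg _).trans (c2 t ht)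
  calc _ ≤ |F₁ t / φ₁ t| + |F t * φ₂ t / φ₁ t ^ 2| := abs_sub _ _
    _ = |F₁ t| / |φ₁ t| + |F t| * |φ₂ t| / |φ₁ t| ^ 2 := by
      rw [abs_div, abs_div, abs_mul, abs_pow]
    _ ≤ _ := by
      gcongr
      exacts [b1 t ht, c1 t ht, b0 t ht, c2 t ht, c1 t ht]

theorem norm_integral_mul_cexp_le_of_deriv_two {F F₁ F₂ φ φ₁ φ₂ φ₃ : ℝ → ℝ} {a ρ κ : ℝ}
    (hF : ∀ t ∈ Set.Icc (1 / 2 : ℝ) (3 / 2), HasDerivAt F (F₁ t) t)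
    (hF₁ : ∀ t ∈ Set.Icc (1 / 2 : ℝ) (3 / 2), HasDerivAt F₁ (F₂ t) t)
    (hφ : ∀ t ∈ Set.Icc (1 / 2 : ℝ) (3 / 2), HasDerivAt φ (φ₁ t) t)
    (hφ₁ : ∀ t ∈ Set.Icc (1 / 2 : ℝ) (3 / 2), HasDerivAt φ₁ (φ₂ t) t)
    (hφ₂ : ∀ t ∈ Set.Icc (1 / 2 : ℝ) (3 / 2), HasDerivAt φ₂ (φ₃ t) t)
    (hF₂ : ContinuousOn F₂ (Set.Icc (1 / 2 : ℝ) (3 / 2)))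
    (hφ₃ : ContinuousOn φ₃ (Set.Icc (1 / 2 : ℝ) (3 / 2)))
    (ha : F (1 / 2) = 0) (hb : F (3 / 2) = 0) (ha' : F₁ (1 / 2) = 0) (hb' : F₁ (3 / 2) = 0)
    (hρ : 0 < ρ)
    (b0 : ∀ t ∈ Set.Icc (1 / 2 : ℝ) (3 / 2), |F t| ≤ a)
    (b1 : ∀ t ∈ Set.Icc (1 / 2 : ℝ) (3 / 2), |F₁ t| ≤ a)
    (b2 : ∀ t ∈ Set.Icc (1 / 2 : ℝ) (3 / 2), |F₂ t| ≤ a)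
    (c1 : ∀ t ∈ Set.Icc (1 / 2 : ℝ) (3 / 2), ρ ≤ |φ₁ t|)
    (c2 : ∀ t ∈ Set.Icc (1 / 2 : ℝ) (3 / 2), |φ₂ t| ≤ κ * ρ)
    (c3 : ∀ t ∈ Set.Icc (1 / 2 : ℝ) (3 / 2), |φ₃ t| ≤ κ * ρ) :
    ‖∫ t in (1 / 2 : ℝ)..(3 / 2), (F t : ℂ) * Complex.exp (Complex.I * (φ t : ℝ))‖ ≤
      a * (1 + 4 * κ + 3 * κ ^ 2) / ρ ^ 2 := by
  have h0 : ∀ t ∈ Set.Icc (1 / 2 : ℝ) (3 / 2), φ₁ t ≠ 0 :=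
    fun t ht => abs_pos.1 (hρ.trans_le (c1 t ht))
  have cc : ∀ {f g : ℝ → ℝ}, (∀ t ∈ Set.Icc (1 / 2 : ℝ) (3 / 2), HasDerivAt f (g t) t) →
      ContinuousOn f (Set.Icc (1 / 2 : ℝ) (3 / 2)) :=
    fun h t ht => (h t ht).continuousAt.continuousWithinAt
  have half : (1 / 2 : ℝ) ∈ Set.Icc (1 / 2 : ℝ) (3 / 2) := by norm_num
  have hκ : 0 ≤ κ := by
    have := (abs_nonneg _).trans (c2 _ half)
    exact nonneg_of_mul_nonneg_left this hρ
  have ha0 := (abs_nonneg _).trans (b0 _ half)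
  have dG : ∀ t ∈ Set.Icc (1 / 2 : ℝ) (3 / 2),
      HasDerivAt (fun t => F₁ t / φ₁ t - F t * φ₂ t / φ₁ t ^ 2)
        (F₂ t / φ₁ t - 2 * (F₁ t * φ₂ t) / φ₁ t ^ 2 - F t * φ₃ t / φ₁ t ^ 2
          + 2 * (F t * φ₂ t ^ 2) / φ₁ t ^ 3) t := by
    intro t ht
    have h := h0 t ht
    refine (((hF₁ t ht).div (hφ₁ t ht) h).sub
      (((hF t ht).mul (hφ₂ t ht)).div ((hφ₁ t ht).pow 2) (pow_ne_zero 2 h))).congr_deriv ?_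
    simp only [Pi.mul_apply, Pi.pow_apply]
    push_cast
    field_simp
    ring
  have cG : ContinuousOn (fun t => F₂ t / φ₁ t - 2 * (F₁ t * φ₂ t) / φ₁ t ^ 2 -
      F t * φ₃ t / φ₁ t ^ 2 + 2 * (F t * φ₂ t ^ 2) / φ₁ t ^ 3) (Set.Icc (1 / 2 : ℝ) (3 / 2)) := by
    have n2 := fun t ht => pow_ne_zero 2 (h0 t ht)
    have n3 := fun t ht => pow_ne_zero 3 (h0 t ht)
    exact (((hF₂.div (cc hφ₁) h0).sub ((continuousOn_const.mul
      ((cc hF₁).mul (cc hφ₂))).div ((cc hφ₁).pow 2) n2)).sub (((cc hF).mul hφ₃).div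
      ((cc hφ₁).pow 2) n2)).add ((continuousOn_const.mul ((cc hF).mul ((cc hφ₂).pow 2))).div
      ((cc hφ₁).pow 3) n3)
  rw [integral_mul_cexp_eq (by norm_num) hF hφ hφ₁ (cc hF₁) (cc hφ₂) h0 ha hb, norm_mul,
    Complex.norm_I, one_mul]
  refine (norm_integral_mul_cexp_le_of_deriv (a₀ := a / ρ + a * (κ * ρ) / ρ ^ 2)
    (a₁ := a / ρ + 2 * (a * (κ * ρ)) / ρ ^ 2 + a * (κ * ρ) / ρ ^ 2
      + 2 * (a * (κ * ρ) ^ 2) / ρ ^ 3)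
    dG hφ hφ₁ cG (cc hφ₂) (by simp only [ha, ha', zero_mul, zero_div, sub_zero])
    (by simp only [hb, hb', zero_mul, zero_div, sub_zero]) hρ ?_ ?_ c1 c2).trans ?_
  · intro t ht
    calc _ ≤ |F₁ t / φ₁ t| + |F t * φ₂ t / φ₁ t ^ 2| := abs_sub _ _
      _ = |F₁ t| / |φ₁ t| + |F t| * |φ₂ t| / |φ₁ t| ^ 2 := by
        rw [abs_div, abs_div, abs_mul, abs_pow]
      _ ≤ _ := by
        gcongr
        exacts [b1 t ht, c1 t ht, b0 t ht, c2 t ht, c1 t ht]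
  · intro t ht
    calc _ ≤ |F₂ t / φ₁ t| + |2 * (F₁ t * φ₂ t) / φ₁ t ^ 2| + |F t * φ₃ t / φ₁ t ^ 2| +
          |2 * (F t * φ₂ t ^ 2) / φ₁ t ^ 3| :=
        (abs_add_le _ _).trans (add_le_add_left ((abs_sub _ _).trans
          (add_le_add_left (abs_sub _ _) _)) _)
      _ = |F₂ t| / |φ₁ t| + 2 * (|F₁ t| * |φ₂ t|) / |φ₁ t| ^ 2 + |F t| * |φ₃ t| / |φ₁ t| ^ 2 +
          2 * (|F t| * |φ₂ t| ^ 2) / |φ₁ t| ^ 3 := by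
        simp only [abs_div, abs_mul, abs_pow, abs_two]
      _ ≤ _ := by
        gcongr
        exacts [b2 t ht, c1 t ht, b1 t ht, c2 t ht, c1 t ht, b0 t ht, c3 t ht, c1 t ht, b0 t ht,
          c2 t ht, c1 t ht]
  · apply le_of_eq
    field_simp
    ring

/-- The rescaled weight `√(ε² + t²/4)`. -/
def scaledBet (ε t : ℝ) : ℝ := Real.sqrt (ε ^ 2 + t ^ 2 / 4)

theorem scaledBet_sq (ε t : ℝ) : scaledBet ε t ^ 2 = ε ^ 2 + t ^ 2 / 4 :=
  Real.sq_sqrt (by positivity)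

theorem le_scaledBet (ε t : ℝ) : t / 2 ≤ scaledBet ε t := by
  apply Real.le_sqrt_of_sq_le
  nlinarith [sq_nonneg ε]

theorem scaledBet_le {ε t : ℝ} (hε : 0 ≤ ε) (hε1 : ε ≤ 1)
    (ht : t ∈ Set.Icc (1 / 2 : ℝ) (3 / 2)) : scaledBet ε t ≤ 5 / 4 := by
  apply Real.sqrt_le_iff.2
  constructor
  · norm_num
  · nlinarith [ht.1, ht.2]

theorem quarter_le_scaledBet {ε t : ℝ} (ht : t ∈ Set.Icc (1 / 2 : ℝ) (3 / 2)) :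
    1 / 4 ≤ scaledBet ε t :=
  le_trans (by linarith [ht.1]) (le_scaledBet ε t)

theorem hasDerivAt_scaledBet {ε t : ℝ} (ht : t ∈ Set.Icc (1 / 2 : ℝ) (3 / 2)) :
    HasDerivAt (scaledBet ε) (t / (4 * scaledBet ε t)) t := by
  have h0 : ε ^ 2 + t ^ 2 / 4 ≠ 0 := by have := ht.1; positivity
  have h := (((hasDerivAt_id t).pow 2).div_const 4).const_add (ε ^ 2)
  refine (h.sqrt h0).congr_deriv ?_
  have : scaledBet ε t ≠ 0 := by linarith [quarter_le_scaledBet (ε := ε) ht]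
  change _ / (2 * scaledBet ε t) = _
  simp only [id]
  field_simp
  norm_num

theorem hasDerivAt_scaledBet_two {ε t : ℝ} (ht : t ∈ Set.Icc (1 / 2 : ℝ) (3 / 2)) :
    HasDerivAt (fun t => t / (4 * scaledBet ε t)) (ε ^ 2 / (4 * scaledBet ε t ^ 3)) t := by
  have h0 : scaledBet ε t ≠ 0 := by linarith [quarter_le_scaledBet (ε := ε) ht]
  refine ((hasDerivAt_id t).div ((hasDerivAt_scaledBet ht).const_mul 4)
    (by positivity)).congr_deriv ?_
  have h := scaledBet_sq ε t
  simp only [id]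
  field_simp
  linear_combination 4 * h

theorem hasDerivAt_scaledBet_three {ε t : ℝ} (ht : t ∈ Set.Icc (1 / 2 : ℝ) (3 / 2)) :
    HasDerivAt (fun t => ε ^ 2 / (4 * scaledBet ε t ^ 3))
      (-(3 * ε ^ 2 * t) / (16 * scaledBet ε t ^ 5)) t := by
  have h0 : scaledBet ε t ≠ 0 := by linarith [quarter_le_scaledBet (ε := ε) ht]
  refine ((hasDerivAt_const t (ε ^ 2)).div (((hasDerivAt_scaledBet ht).pow 3).const_mul 4)
    (by simp [h0])).congr_deriv ?_
  simp only [Pi.pow_apply]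
  field_simp
  norm_num
  ring

theorem scaledBet_deriv_mem {ε t : ℝ} (ht : t ∈ Set.Icc (1 / 2 : ℝ) (3 / 2)) :
    0 ≤ t / (4 * scaledBet ε t) ∧ t / (4 * scaledBet ε t) ≤ 1 / 2 := by
  have h0 : 0 < scaledBet ε t := by linarith [quarter_le_scaledBet (ε := ε) ht]
  have h1 := le_scaledBet ε t
  have := ht.1
  refine ⟨by positivity, ?_⟩
  rw [div_le_iff₀ (by positivity)]
  linarith

theorem scaledBet_deriv_two_le {ε t : ℝ} (ht : t ∈ Set.Icc (1 / 2 : ℝ) (3 / 2)) :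
    ε ^ 2 / (4 * scaledBet ε t ^ 3) ≤ 16 * ε ^ 2 := by
  have h0 := quarter_le_scaledBet (ε := ε) ht
  have : (1 / 4) ^ 3 ≤ scaledBet ε t ^ 3 := by gcongr
  rw [div_le_iff₀ (by positivity)]
  nlinarith [sq_nonneg ε]

theorem abs_scaledBet_deriv_three_le {ε t : ℝ} (ht : t ∈ Set.Icc (1 / 2 : ℝ) (3 / 2)) :
    |-(3 * ε ^ 2 * t) / (16 * scaledBet ε t ^ 5)| ≤ 288 * ε ^ 2 := by
  have h0 := quarter_le_scaledBet (ε := ε) ht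
  have ht0 : 0 ≤ t := by linarith [ht.1]
  have : (1 / 4) ^ 5 ≤ scaledBet ε t ^ 5 := by gcongr
  have h5 : 0 < scaledBet ε t ^ 5 := by positivity
  rw [abs_div, abs_neg, abs_of_nonneg (by positivity), abs_of_pos (by positivity),
    div_le_iff₀ (by positivity)]
  have h1 : 3 * ε ^ 2 * t ≤ 3 * ε ^ 2 * (3 / 2) := by gcongr; exact ht.2
  nlinarith [sq_nonneg ε]

theorem half_sub_scaledBet_deriv {ε t : ℝ} (ht : t ∈ Set.Icc (1 / 2 : ℝ) (3 / 2)) :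
    1 / 2 - t / (4 * scaledBet ε t) =
      ε ^ 2 * (1 / (scaledBet ε t * (2 * scaledBet ε t + t))) := by
  have h0 := quarter_le_scaledBet (ε := ε) ht
  have h1 : scaledBet ε t ≠ 0 := by linarith
  have h2 : 2 * scaledBet ε t + t ≠ 0 := by linarith [ht.1]
  have h := scaledBet_sq ε t
  field_simp
  linear_combination 8 * h

theorem scaledBet_weight_mem {ε t : ℝ} (hε : 0 ≤ ε) (hε1 : ε ≤ 1)
    (ht : t ∈ Set.Icc (1 / 2 : ℝ) (3 / 2)) :
    1 / 5 ≤ 1 / (scaledBet ε t * (2 * scaledBet ε t + t)) ∧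
      1 / (scaledBet ε t * (2 * scaledBet ε t + t)) ≤ 4 := by
  have h0 := quarter_le_scaledBet (ε := ε) ht
  have h1 := le_scaledBet ε t
  have h2 := scaledBet_le hε hε1 ht
  have hp : 0 < scaledBet ε t * (2 * scaledBet ε t + t) := by
    have := ht.1; positivity
  obtain ⟨a, b⟩ := ht
  constructor
  · rw [div_le_div_iff₀ (by norm_num) hp]
    nlinarith
  · rw [div_le_iff₀ hp]
    nlinarith

theorem abs_half_sub_scaledBet_le {ε t : ℝ} (ht : t ∈ Set.Icc (1 / 2 : ℝ) (3 / 2)) :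
    |t / 2 - scaledBet ε t| ≤ 2 * ε ^ 2 := by
  have h0 := quarter_le_scaledBet (ε := ε) ht
  have h1 := le_scaledBet ε t
  have h := scaledBet_sq ε t
  rw [abs_sub_comm, abs_of_nonneg (by linarith)]
  obtain ⟨a, b⟩ := ht
  nlinarith

theorem continuous_scaledBet (ε : ℝ) : Continuous (scaledBet ε) := by
  unfold scaledBet; fun_prop

/-- A bump function on `[1/2, 3/2]`, with its first two derivatives, all of size at most `E`. -/
structure IsBump (e e₁ e₂ : ℝ → ℝ) (E : ℝ) : Prop where
  hasDerivAt : ∀ t, HasDerivAt e (e₁ t) t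
  hasDerivAt' : ∀ t, HasDerivAt e₁ (e₂ t) t
  cont : Continuous e₂
  left : e (1 / 2) = 0
  right : e (3 / 2) = 0
  left' : e₁ (1 / 2) = 0
  right' : e₁ (3 / 2) = 0
  le : ∀ t, |e t| ≤ E
  le' : ∀ t, |e₁ t| ≤ E
  le'' : ∀ t, |e₂ t| ≤ E

namespace IsBump

variable {e e₁ e₂ : ℝ → ℝ} {E : ℝ}

theorem continuous (h : IsBump e e₁ e₂ E) : Continuous e :=
  continuous_iff_continuousAt.2 fun t => (h.hasDerivAt t).continuousAt

theorem continuous' (h : IsBump e e₁ e₂ E) : Continuous e₁ :=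
  continuous_iff_continuousAt.2 fun t => (h.hasDerivAt' t).continuousAt

theorem nonneg (h : IsBump e e₁ e₂ E) : 0 ≤ E := (abs_nonneg _).trans (h.le 0)

theorem abs_div_scaledBet_le (h : IsBump e e₁ e₂ E) {ε t : ℝ}
    (ht : t ∈ Set.Icc (1 / 2 : ℝ) (3 / 2)) : |e t / scaledBet ε t| ≤ 4 * E := by
  have h0 := quarter_le_scaledBet (ε := ε) ht
  have hE := h.nonneg
  rw [abs_div, abs_of_pos (by linarith : 0 < scaledBet ε t), div_le_iff₀ (by linarith)]
  nlinarith [h.le t]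

theorem hasDerivAt_div_scaledBet (h : IsBump e e₁ e₂ E) {ε t : ℝ}
    (ht : t ∈ Set.Icc (1 / 2 : ℝ) (3 / 2)) :
    HasDerivAt (fun t => e t / scaledBet ε t)
      (e₁ t / scaledBet ε t - e t / scaledBet ε t * (t / (4 * scaledBet ε t)) / scaledBet ε t)
      t := by
  have h0 : scaledBet ε t ≠ 0 := by linarith [quarter_le_scaledBet (ε := ε) ht]
  refine ((h.hasDerivAt t).div (hasDerivAt_scaledBet ht) h0).congr_deriv ?_
  field_simp

theorem abs_deriv_div_scaledBet_le (h : IsBump e e₁ e₂ E) {ε t : ℝ}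
    (ht : t ∈ Set.Icc (1 / 2 : ℝ) (3 / 2)) :
    |e₁ t / scaledBet ε t - e t / scaledBet ε t * (t / (4 * scaledBet ε t)) / scaledBet ε t| ≤
      12 * E := by
  have h0 := quarter_le_scaledBet (ε := ε) ht
  have hp : 0 < scaledBet ε t := by linarith
  have hE := h.nonneg
  have h1 := h.abs_div_scaledBet_le (ε := ε) ht
  obtain ⟨h2, h3⟩ := scaledBet_deriv_mem (ε := ε) ht
  have a1 : |e₁ t / scaledBet ε t| ≤ 4 * E := by
    rw [abs_div, abs_of_pos hp, div_le_iff₀ hp]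
    nlinarith [h.le' t]
  have a2 : |e t / scaledBet ε t * (t / (4 * scaledBet ε t)) / scaledBet ε t| ≤ 8 * E := by
    rw [abs_div, abs_of_pos hp, div_le_iff₀ hp, abs_mul, abs_of_nonneg h2]
    calc _ ≤ 4 * E * (1 / 2) := by gcongr
      _ ≤ _ := by nlinarith
  exact (abs_sub _ _).trans (by linarith)

/-- The integral of `e / β` against `sin (tλ - βμ)`. -/
theorem abs_integral_sin_le (h : IsBump e e₁ e₂ E) {ε l m : ℝ} (hε : 0 ≤ ε) (hε1 : ε ≤ 1) :
    |∫ t in (1 / 2 : ℝ)..(3 / 2), e t / scaledBet ε t * Real.sin (t * l - scaledBet ε t * m)| ≤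
      6520 * E * (min |l - m / 2| |l - m / 2|⁻¹ + min |ε ^ 2 * m| |ε ^ 2 * m|⁻¹ +
        min (|l - m / 2| / |ε ^ 2 * m|) (|l - m / 2| / |ε ^ 2 * m|)⁻¹) := by
  have hE := h.nonneg
  set r := l - m / 2 with hr
  set d := ε ^ 2 * m with hd
  set S := ∫ t in (1 / 2 : ℝ)..(3 / 2),
    e t / scaledBet ε t * Real.sin (t * l - scaledBet ε t * m) with hS
  have cB := continuous_scaledBet ε
  have cB1 : ContinuousOn (fun t => t / (4 * scaledBet ε t)) (Set.Icc (1 / 2 : ℝ) (3 / 2)) :=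
    fun t ht => (hasDerivAt_scaledBet_two ht).continuousAt.continuousWithinAt
  have cB2 : ContinuousOn (fun t => ε ^ 2 / (4 * scaledBet ε t ^ 3))
      (Set.Icc (1 / 2 : ℝ) (3 / 2)) :=
    fun t ht => (hasDerivAt_scaledBet_three ht).continuousAt.continuousWithinAt
  have nB : ∀ t ∈ Set.Icc (1 / 2 : ℝ) (3 / 2), scaledBet ε t ≠ 0 := fun t ht => by
    linarith [quarter_le_scaledBet (ε := ε) ht]
  have ceB : ContinuousOn (fun t => e t / scaledBet ε t) (Set.Icc (1 / 2 : ℝ) (3 / 2)) :=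
    h.continuous.continuousOn.div cB.continuousOn nB
  have triv : ∀ c, (∀ t ∈ Set.Icc (1 / 2 : ℝ) (3 / 2),
      |Real.sin (t * l - scaledBet ε t * m)| ≤ c) → |S| ≤ 4 * E * c := by
    intro c hc
    have := intervalIntegral.norm_integral_le_of_norm_le_const (a := (1 / 2 : ℝ)) (b := 3 / 2)
      (C := 4 * E * c)
      (f := fun t => e t / scaledBet ε t * Real.sin (t * l - scaledBet ε t * m)) ?_
    · norm_num at this ⊢; exact this
    · intro t ht
      rw [Set.uIoc_of_le (by norm_num)] at ht
      have ht' : t ∈ Set.Icc (1 / 2 : ℝ) (3 / 2) := ⟨ht.1.le, ht.2⟩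
      rw [Real.norm_eq_abs, abs_mul]
      have := h.abs_div_scaledBet_le (ε := ε) ht'
      have := hc t ht'
      gcongr
  have small : |S| ≤ 8 * E * (|r| + |d|) := by
    refine (triv (2 * (|r| + |d|)) ?_).trans (by linarith)
    intro t ht
    refine Real.abs_sin_le_abs.trans ?_
    have e1 : t * l - scaledBet ε t * m = t * r + (t / 2 - scaledBet ε t) * m := by
      rw [hr]; ring
    rw [e1]
    refine (abs_add_le _ _).trans ?_
    rw [abs_mul, abs_mul, abs_of_nonneg (by linarith [ht.1] : 0 ≤ t)]
    have h1 := abs_half_sub_scaledBet_le (ε := ε) ht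
    have h2 : |d| = ε ^ 2 * |m| := by rw [hd, abs_mul, abs_of_nonneg (sq_nonneg ε)]
    have h3 : |t / 2 - scaledBet ε t| * |m| ≤ 2 * ε ^ 2 * |m| := by gcongr
    nlinarith [ht.2, abs_nonneg r]
  have osc : ∀ ρ, 0 < ρ → (∀ t ∈ Set.Icc (1 / 2 : ℝ) (3 / 2),
      ρ ≤ |r + d * (1 / (scaledBet ε t * (2 * scaledBet ε t + t)))|) →
      |S| ≤ 12 * E / ρ + 4 * E * (16 * |d|) / ρ ^ 2 := by
    intro ρ hρ hlow
    set Z := ∫ t in (1 / 2 : ℝ)..(3 / 2), ((e t / scaledBet ε t : ℝ) : ℂ) *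
      Complex.exp (Complex.I * ((t * l - scaledBet ε t * m : ℝ) : ℂ)) with hZ
    have hSZ : S = Z.im := by
      have hi : IntervalIntegrable (fun t => ((e t / scaledBet ε t : ℝ) : ℂ) *
          Complex.exp (Complex.I * ((t * l - scaledBet ε t * m : ℝ) : ℂ))) volume
          (1 / 2) (3 / 2) := by
        apply ContinuousOn.intervalIntegrable
        rw [Set.uIcc_of_le (by norm_num)]
        refine (Complex.continuous_ofReal.comp_continuousOn ceB).mul (Continuous.continuousOn ?_)
        fun_prop
      have := Complex.imCLM.intervalIntegral_comp_comm hi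
      simp only [Complex.imCLM_apply] at this
      rw [hZ, ← this, hS]
      congr 1
      ext t
      rw [mul_comm Complex.I, Complex.im_ofReal_mul, Complex.exp_ofReal_mul_I_im]
    rw [hSZ]
    refine (Complex.abs_im_le_norm Z).trans ?_
    refine norm_integral_mul_cexp_le_of_deriv
      (φ₁ := fun t => l - t / (4 * scaledBet ε t) * m)
      (φ₂ := fun t => -(ε ^ 2 / (4 * scaledBet ε t ^ 3) * m))
      (fun t ht => h.hasDerivAt_div_scaledBet ht) ?_ ?_ ?_ ?_ ?_ ?_ hρ
      (fun t ht => h.abs_div_scaledBet_le ht) (fun t ht => h.abs_deriv_div_scaledBet_le ht) ?_ ?_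
    · intro t ht
      refine (((hasDerivAt_id t).mul_const l).sub
        ((hasDerivAt_scaledBet ht).mul_const m)).congr_deriv ?_
      ring
    · intro t ht
      refine (((hasDerivAt_scaledBet_two ht).mul_const m).const_sub l)
    · exact (h.continuous'.continuousOn.div cB.continuousOn nB).sub
        ((ceB.mul cB1).div cB.continuousOn nB)
    · exact (cB2.mul continuousOn_const).neg
    · simp only [h.left, zero_div]
    · simp only [h.right, zero_div]
    · intro t ht
      convert hlow t ht using 2
      have := half_sub_scaledBet_deriv (ε := ε) ht
      rw [hr, hd]
      linear_combination m * this
    · intro t ht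
      have h1 := scaledBet_deriv_two_le (ε := ε) ht
      have h0 := quarter_le_scaledBet (ε := ε) ht
      have h2 : 0 ≤ ε ^ 2 / (4 * scaledBet ε t ^ 3) := by
        have : 0 < scaledBet ε t := by linarith
        positivity
      rw [abs_neg, abs_mul, abs_of_nonneg h2, hd, abs_mul, abs_of_nonneg (sq_nonneg ε)]
      have := mul_le_mul_of_nonneg_right h1 (abs_nonneg m)
      linarith
  have hmin : ∀ x : ℝ, 0 ≤ x → 0 ≤ min x x⁻¹ := fun x hx => le_min hx (inv_nonneg.2 hx)
  have m1 := hmin |r| (abs_nonneg _)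
  have m2 := hmin |d| (abs_nonneg _)
  have m3 := hmin (|r| / |d|) (by positivity)
  have hw := fun t ht => scaledBet_weight_mem (t := t) hε hε1 ht
  by_cases c1 : 8 * |d| ≤ |r|
  · suffices |S| ≤ 56 * E * min |r| |r|⁻¹ by
      nlinarith [mul_nonneg hE m1, mul_nonneg hE m2, mul_nonneg hE m3]
    rcases (abs_nonneg r).eq_or_lt with hr0 | hr0
    · have hd0 : |d| = 0 := by linarith [abs_nonneg d]
      rw [← hr0, hd0] at small
      rw [← hr0]
      simpa using small
    rw [mul_min_of_nonneg _ _ (by positivity)]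
    apply le_min
    · nlinarith [abs_nonneg d]
    · refine (osc (|r| / 2) (by positivity) ?_).trans ?_
      · intro t ht
        obtain ⟨w1, w2⟩ := hw t ht
        set w := 1 / (scaledBet ε t * (2 * scaledBet ε t + t))
        have : |d * w| ≤ |d| * 4 := by
          rw [abs_mul, abs_of_nonneg (by linarith : 0 ≤ w)]; gcongr
        have h3 := abs_sub_abs_le_abs_sub r (-(d * w))
        rw [abs_neg, sub_neg_eq_add] at h3
        linarith
      · have e1 : 12 * E / (|r| / 2) + 4 * E * (16 * |d|) / (|r| / 2) ^ 2 =
            24 * E * |r|⁻¹ + 32 * E * (8 * |d|) * (|r|⁻¹ * |r|⁻¹) := by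
          field_simp; ring
        rw [e1]
        have : 32 * E * (8 * |d|) * (|r|⁻¹ * |r|⁻¹) ≤ 32 * E * |r| * (|r|⁻¹ * |r|⁻¹) := by gcongr
        have e2 : 32 * E * |r| * (|r|⁻¹ * |r|⁻¹) = 32 * E * |r|⁻¹ := by field_simp
        linarith
  · by_cases c2 : 10 * |r| ≤ |d|
    · suffices |S| ≤ 6520 * E * min |d| |d|⁻¹ by
        nlinarith [mul_nonneg hE m1, mul_nonneg hE m2, mul_nonneg hE m3]
      have hd0 : 0 < |d| := by linarith [abs_nonneg r]
      rw [mul_min_of_nonneg _ _ (by positivity)]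
      apply le_min
      · nlinarith [abs_nonneg d]
      · refine (osc (|d| / 10) (by positivity) ?_).trans ?_
        · intro t ht
          obtain ⟨w1, w2⟩ := hw t ht
          set w := 1 / (scaledBet ε t * (2 * scaledBet ε t + t))
          have : |d| * (1 / 5) ≤ |d * w| := by
            rw [abs_mul d w, abs_of_nonneg (by linarith : 0 ≤ w)]; gcongr
          have h3 := abs_sub_abs_le_abs_sub (d * w) (-r)
          rw [abs_neg, sub_neg_eq_add, add_comm] at h3
          linarith
        · apply le_of_eq
          field_simp; ring
    · push Not at c1 c2
      have hd0 : 0 < |d| := by linarith [abs_nonneg r]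
      have hr0 : 0 < |r| := by linarith [abs_nonneg d]
      have t1 := triv 1 (fun t _ => Real.abs_sin_le_one _)
      suffices 1 / 10 ≤ min (|r| / |d|) (|r| / |d|)⁻¹ by
        nlinarith [mul_nonneg hE m1, mul_nonneg hE m2, mul_nonneg hE m3]
      apply le_min
      · rw [div_le_div_iff₀ (by norm_num) hd0]; linarith
      · rw [inv_div, div_le_div_iff₀ (by norm_num) hr0]; linarith

end IsBump

namespace IsBump

variable {e e₁ e₂ : ℝ → ℝ} {E : ℝ}

theorem abs_integral_cos_add_le (h : IsBump e e₁ e₂ E) {ε l n : ℝ} (hε : 0 ≤ ε) (hε1 : ε ≤ 1)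
    (hl : l ≠ 0) (hn : |n| ≤ |l|) :
    |∫ t in (1 / 2 : ℝ)..(3 / 2), e t * Real.cos (t * l + scaledBet ε t * n)| ≤
      3990532 * E * (min |l| |l|⁻¹ / |l|) := by
  have hl' := abs_pos.2 hl
  have hE := h.nonneg
  have cB := continuous_scaledBet ε
  have hε2 : ε ^ 2 ≤ 1 := by nlinarith
  set Z := ∫ t in (1 / 2 : ℝ)..(3 / 2), ((e t : ℝ) : ℂ) *
    Complex.exp (Complex.I * ((t * l + scaledBet ε t * n : ℝ) : ℂ)) with hZ
  have hSZ : (∫ t in (1 / 2 : ℝ)..(3 / 2), e t * Real.cos (t * l + scaledBet ε t * n)) =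
      Z.re := by
    have hi : IntervalIntegrable (fun t => ((e t : ℝ) : ℂ) *
        Complex.exp (Complex.I * ((t * l + scaledBet ε t * n : ℝ) : ℂ))) volume
        (1 / 2) (3 / 2) := by
      apply Continuous.intervalIntegrable
      have := h.continuous
      fun_prop
    have := Complex.reCLM.intervalIntegral_comp_comm hi
    simp only [Complex.reCLM_apply] at this
    rw [hZ, ← this]
    congr 1
    ext t
    rw [mul_comm Complex.I, Complex.re_ofReal_mul, Complex.exp_ofReal_mul_I_re]
  have b1 : ‖Z‖ ≤ E := norm_integral_mul_cexp_le_const fun t _ => h.le t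
  have b2 : ‖Z‖ ≤ E * (1 + 4 * 576 + 3 * 576 ^ 2) / (|l| / 2) ^ 2 := by
    refine norm_integral_mul_cexp_le_of_deriv_two
      (F₁ := e₁) (F₂ := e₂)
      (φ₁ := fun t => l + t / (4 * scaledBet ε t) * n)
      (φ₂ := fun t => ε ^ 2 / (4 * scaledBet ε t ^ 3) * n)
      (φ₃ := fun t => -(3 * ε ^ 2 * t) / (16 * scaledBet ε t ^ 5) * n)
      (fun t _ => h.hasDerivAt t) (fun t _ => h.hasDerivAt' t) ?_ ?_ ?_
      h.cont.continuousOn ?_ h.left h.right h.left' h.right' (by positivity)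
      (fun t _ => h.le t) (fun t _ => h.le' t) (fun t _ => h.le'' t) ?_ ?_ ?_
    · intro t ht
      refine (((hasDerivAt_id t).mul_const l).add
        ((hasDerivAt_scaledBet ht).mul_const n)).congr_deriv ?_
      ring
    · intro t ht
      exact ((hasDerivAt_scaledBet_two ht).mul_const n).const_add l
    · intro t ht
      exact (hasDerivAt_scaledBet_three ht).mul_const n
    · refine ContinuousOn.mul (ContinuousOn.div (by fun_prop) (by fun_prop) fun t ht => ?_)
        continuousOn_const
      have := quarter_le_scaledBet (ε := ε) ht
      have : 0 < scaledBet ε t := by linarith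
      positivity
    · intro t ht
      obtain ⟨h1, h2⟩ := scaledBet_deriv_mem (ε := ε) ht
      have h3 : |t / (4 * scaledBet ε t) * n| ≤ 1 / 2 * |l| := by
        rw [abs_mul, abs_of_nonneg h1]; gcongr
      have h4 := abs_sub_abs_le_abs_sub l (-(t / (4 * scaledBet ε t) * n))
      rw [abs_neg, sub_neg_eq_add] at h4
      linarith
    · intro t ht
      have h1 := scaledBet_deriv_two_le (ε := ε) ht
      have h0 := quarter_le_scaledBet (ε := ε) ht
      have h2 : 0 ≤ ε ^ 2 / (4 * scaledBet ε t ^ 3) := by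
        have : 0 < scaledBet ε t := by linarith
        positivity
      rw [abs_mul, abs_of_nonneg h2]
      calc _ ≤ (16 * 1) * |l| := by gcongr; linarith
        _ ≤ _ := by linarith
    · intro t ht
      have h1 := abs_scaledBet_deriv_three_le (ε := ε) ht
      rw [abs_mul]
      calc _ ≤ (288 * 1) * |l| := by gcongr; linarith
        _ ≤ _ := by linarith
  rw [hSZ]
  refine (Complex.abs_re_le_norm Z).trans ?_
  rw [← min_div_div_right hl'.le, div_self hl'.ne', mul_min_of_nonneg _ _ (by positivity)]
  apply le_min
  · linarith
  · refine b2.trans (le_of_eq ?_)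
    field_simp
    norm_num
    ring

/-- The integral of `e` against `cos (tλ) cos (βν)`. -/
theorem abs_integral_cos_mul_cos_le (h : IsBump e e₁ e₂ E) {ε l n : ℝ} (hε : 0 ≤ ε)
    (hε1 : ε ≤ 1) (hl : l ≠ 0) (hn : |n| ≤ |l|) :
    |∫ t in (1 / 2 : ℝ)..(3 / 2), e t * Real.cos (t * l) * Real.cos (scaledBet ε t * n)| ≤
      3990532 * E * (min |l| |l|⁻¹ / |l|) := by
  have h1 := h.abs_integral_cos_add_le hε hε1 hl hn
  have h2 := h.abs_integral_cos_add_le hε hε1 hl (n := -n) (by rwa [abs_neg])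
  have cB := continuous_scaledBet ε
  have ce := h.continuous
  have key : (∫ t in (1 / 2 : ℝ)..(3 / 2),
      e t * Real.cos (t * l) * Real.cos (scaledBet ε t * n)) =
      ((∫ t in (1 / 2 : ℝ)..(3 / 2), e t * Real.cos (t * l + scaledBet ε t * n)) +
      ∫ t in (1 / 2 : ℝ)..(3 / 2), e t * Real.cos (t * l + scaledBet ε t * -n)) / 2 := by
    rw [← intervalIntegral.integral_add, ← intervalIntegral.integral_div]
    · congr 1
      ext t
      rw [mul_neg, ← sub_eq_add_neg, Real.cos_add, Real.cos_sub]
      ring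
    all_goals
      apply Continuous.intervalIntegrable
      fun_prop
  rw [key, abs_div, abs_two]
  linarith [abs_add_le
    (∫ t in (1 / 2 : ℝ)..(3 / 2), e t * Real.cos (t * l + scaledBet ε t * n))
    (∫ t in (1 / 2 : ℝ)..(3 / 2), e t * Real.cos (t * l + scaledBet ε t * -n))]

/-- The integral of `e / β` against `cos (tλ) sin (βμ)`, for small `μ`. -/
theorem abs_integral_cos_mul_sin_le (h : IsBump e e₁ e₂ E) {ε l m : ℝ} (hε : 0 ≤ ε)
    (hε1 : ε ≤ 1) (hl : l ≠ 0) (hm : |m| ≤ |l|) :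
    |∫ t in (1 / 2 : ℝ)..(3 / 2),
      e t / scaledBet ε t * Real.cos (t * l) * Real.sin (scaledBet ε t * m)| ≤
      3990532 * E * (min |l| |l|⁻¹ / |l|) * |m| := by
  have cB := continuous_scaledBet ε
  have ce := h.continuous
  have key : (∫ t in (1 / 2 : ℝ)..(3 / 2),
      e t / scaledBet ε t * Real.cos (t * l) * Real.sin (scaledBet ε t * m)) =
      ∫ n in (0 : ℝ)..m, ∫ t in (1 / 2 : ℝ)..(3 / 2),
        e t * Real.cos (t * l) * Real.cos (scaledBet ε t * n) := by
    rw [intervalIntegral_intervalIntegral_swap]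
    · apply intervalIntegral.integral_congr
      intro t ht
      rw [Set.uIcc_of_le (by norm_num)] at ht
      have h0 : scaledBet ε t ≠ 0 := by linarith [quarter_le_scaledBet (ε := ε) ht]
      simp only
      rw [intervalIntegral.integral_const_mul, intervalIntegral.integral_comp_mul_left _ h0,
        integral_cos]
      simp
      ring
    · apply (ContinuousOn.integrableOn_compact (isCompact_uIcc.prod isCompact_uIcc) _).mono_set
        (Set.prod_mono Set.uIoc_subset_uIcc Set.uIoc_subset_uIcc)
      unfold Function.uncurry
      fun_prop
  rw [key]
  have := intervalIntegral.norm_integral_le_of_norm_le_const (a := 0) (b := m)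
    (C := 3990532 * E * (min |l| |l|⁻¹ / |l|))
    (f := fun n => ∫ t in (1 / 2 : ℝ)..(3 / 2),
        e t * Real.cos (t * l) * Real.cos (scaledBet ε t * n)) ?_
  · simpa using this
  · intro n hn
    refine h.abs_integral_cos_mul_cos_le hε hε1 hl (le_trans ?_ hm)
    have := Set.uIoc_subset_uIcc hn
    have := Set.abs_sub_left_of_mem_uIcc this
    simpa using this

end IsBump

/-- The dyadic piece `∫ e(t)/β_ε(t) cos (2ʲ t A) sin (2ʲ β_ε(t) B) dt`, with `ε = 2⁻ʲ`. -/
def dyadicPiece (e : ℝ → ℝ) (j : ℤ) (A B : ℝ) : ℝ :=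
  ∫ t in (1 / 2 : ℝ)..(3 / 2), e t / scaledBet (2 ^ (-j)) t * Real.cos (t * (2 ^ j * A)) *
    Real.sin (scaledBet (2 ^ (-j)) t * (2 ^ j * B))

namespace IsBump

variable {e e₁ e₂ : ℝ → ℝ} {E : ℝ}

theorem abs_dyadicPiece_le (h : IsBump e e₁ e₂ E) {j : ℤ} (hj : 0 ≤ j) (A B : ℝ) :
    |dyadicPiece e j A B| ≤ 6520 * E * (
      (min (2 ^ j * |A - B / 2|) (2 ^ j * |A - B / 2|)⁻¹ +
        min (2 ^ (-j) * |B|) (2 ^ (-j) * |B|)⁻¹ +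
        min (2 ^ (2 * j) * (|A - B / 2| / |B|)) (2 ^ (2 * j) * (|A - B / 2| / |B|))⁻¹) +
      (min (2 ^ j * |A + B / 2|) (2 ^ j * |A + B / 2|)⁻¹ +
        min (2 ^ (-j) * |B|) (2 ^ (-j) * |B|)⁻¹ +
        min (2 ^ (2 * j) * (|A + B / 2| / |B|)) (2 ^ (2 * j) * (|A + B / 2| / |B|))⁻¹)) := by
  have hε : (0 : ℝ) ≤ 2 ^ (-j) := by positivity
  have hε1 : (2 : ℝ) ^ (-j) ≤ 1 := zpow_le_one_of_nonpos₀ (by norm_num) (by omega)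
  have p0 : (0 : ℝ) < 2 ^ j := by positivity
  have main : ∀ B' : ℝ, |B'| = |B| →
      |∫ t in (1 / 2 : ℝ)..(3 / 2), e t / scaledBet (2 ^ (-j)) t *
        Real.sin (t * (2 ^ j * A) - scaledBet (2 ^ (-j)) t * (2 ^ j * B'))| ≤
      6520 * E * (min (2 ^ j * |A - B' / 2|) (2 ^ j * |A - B' / 2|)⁻¹ +
        min (2 ^ (-j) * |B|) (2 ^ (-j) * |B|)⁻¹ +
        min (2 ^ (2 * j) * (|A - B' / 2| / |B|)) (2 ^ (2 * j) * (|A - B' / 2| / |B|))⁻¹) := by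
    intro B' hB'
    have := h.abs_integral_sin_le (l := 2 ^ j * A) (m := 2 ^ j * B') hε hε1
    have r1 : |2 ^ j * A - 2 ^ j * B' / 2| = 2 ^ j * |A - B' / 2| := by
      rw [← abs_of_pos p0, ← abs_mul, abs_of_pos p0]; ring_nf
    have r2 : |((2 : ℝ) ^ (-j)) ^ 2 * (2 ^ j * B')| = 2 ^ (-j) * |B| := by
      rw [← hB', ← abs_of_nonneg hε, ← abs_mul, abs_of_nonneg hε, zpow_neg]
      congr 1
      field_simp
    have r3 : 2 ^ j * |A - B' / 2| / (2 ^ (-j) * |B|) = 2 ^ (2 * j) * (|A - B' / 2| / |B|) := by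
      rw [mul_div_mul_comm, ← zpow_sub₀ two_ne_zero]
      congr 2
      ring
    rwa [r1, r2, r3] at this
  have h1 := main B rfl
  have h2 := main (-B) (abs_neg B)
  rw [neg_div, sub_neg_eq_add] at h2
  have ci : ∀ B' : ℝ, IntervalIntegrable (fun t => e t / scaledBet (2 ^ (-j)) t *
        Real.sin (t * (2 ^ j * A) - scaledBet (2 ^ (-j)) t * (2 ^ j * B'))) volume
        (1 / 2) (3 / 2) := by
    intro B'
    apply ContinuousOn.intervalIntegrable
    rw [Set.uIcc_of_le (by norm_num)]
    have cB := continuous_scaledBet (2 ^ (-j))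
    refine (h.continuous.continuousOn.div cB.continuousOn fun t ht => ?_).mul (by fun_prop)
    linarith [quarter_le_scaledBet (ε := 2 ^ (-j)) ht]
  have key : dyadicPiece e j A B =
      ((∫ t in (1 / 2 : ℝ)..(3 / 2), e t / scaledBet (2 ^ (-j)) t *
        Real.sin (t * (2 ^ j * A) - scaledBet (2 ^ (-j)) t * (2 ^ j * -B))) -
      ∫ t in (1 / 2 : ℝ)..(3 / 2), e t / scaledBet (2 ^ (-j)) t *
        Real.sin (t * (2 ^ j * A) - scaledBet (2 ^ (-j)) t * (2 ^ j * B))) / 2 := by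
    rw [← intervalIntegral.integral_sub (ci _) (ci _), ← intervalIntegral.integral_div,
      dyadicPiece]
    congr 1
    ext t
    rw [mul_neg, mul_neg, sub_neg_eq_add, Real.sin_add, Real.sin_sub]
    ring
  have h0 := abs_nonneg (dyadicPiece e j A B)
  have : 2 * |dyadicPiece e j A B| ≤ |∫ t in (1 / 2 : ℝ)..(3 / 2),
        e t / scaledBet (2 ^ (-j)) t *
        Real.sin (t * (2 ^ j * A) - scaledBet (2 ^ (-j)) t * (2 ^ j * -B))| +
      |∫ t in (1 / 2 : ℝ)..(3 / 2), e t / scaledBet (2 ^ (-j)) t *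
        Real.sin (t * (2 ^ j * A) - scaledBet (2 ^ (-j)) t * (2 ^ j * B))| := by
    rw [key, abs_div, abs_two, mul_div_cancel₀ _ two_ne_zero]
    exact abs_sub _ _
  linarith

theorem abs_dyadicPiece_le_of_abs_le (h : IsBump e e₁ e₂ E) {j : ℤ} (hj : 0 ≤ j) {A B : ℝ}
    (hA : A ≠ 0) (hAB : |B| ≤ |A|) :
    |dyadicPiece e j A B| ≤
      3990532 * E * (|B| / |A|) * min (2 ^ j * |A|) (2 ^ j * |A|)⁻¹ := by
  have hε : (0 : ℝ) ≤ 2 ^ (-j) := by positivity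
  have hε1 : (2 : ℝ) ^ (-j) ≤ 1 := zpow_le_one_of_nonpos₀ (by norm_num) (by omega)
  have p0 : (0 : ℝ) < 2 ^ j := by positivity
  have e1 : ∀ x : ℝ, |2 ^ j * x| = 2 ^ j * |x| := fun x => by rw [abs_mul, abs_of_pos p0]
  have := h.abs_integral_cos_mul_sin_le (l := 2 ^ j * A) (m := 2 ^ j * B) hε hε1
    (by positivity) (by rw [e1, e1]; gcongr)
  rw [e1, e1] at this
  refine this.trans (le_of_eq ?_)
  have := abs_pos.2 hA
  field_simp

/-- The two uniform bounds for sums of dyadic pieces. -/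
theorem exists_sum_abs_dyadicPiece_le (h : IsBump e e₁ e₂ E) :
    ∃ C : ℝ, 0 < C ∧ ∀ A B : ℝ, ∀ J : Finset ℤ, (∀ j ∈ J, 0 ≤ j) →
      ∑ j ∈ J, |dyadicPiece e j A B| ≤ C ∧
      (∑ j ∈ J, |dyadicPiece e j A B|) * |A| ≤ C * |B| := by
  obtain ⟨c, hc, H⟩ := exists_sum_min_zpow_le
  have hE := h.nonneg
  refine ⟨3990532 * E * c + 1, by positivity, fun A B J hJ => ?_⟩
  have first : ∑ j ∈ J, |dyadicPiece e j A B| ≤ 3990532 * E * c + 1 := by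
    refine (Finset.sum_le_sum fun j hj => h.abs_dyadicPiece_le (hJ j hj) A B).trans ?_
    rw [← Finset.mul_sum]
    simp only [Finset.sum_add_distrib]
    have s1 := fun t ht => H id Function.injective_id t ht J
    have s2 := fun t ht => H (fun j => -j) neg_injective t ht J
    have s3 := fun t ht => H (fun j => 2 * j) (fun a b hab => by simpa using hab) t ht J
    have a1 := s1 |A - B / 2| (abs_nonneg _)
    have a2 := s1 |A + B / 2| (abs_nonneg _)
    have a3 := s2 |B| (abs_nonneg _)
    have a4 := s3 (|A - B / 2| / |B|) (by positivity)
    have a5 := s3 (|A + B / 2| / |B|) (by positivity)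
    simp only [id] at a1 a2
    calc _ ≤ 6520 * E * ((c + c + c) + (c + c + c)) := by gcongr
      _ ≤ _ := by nlinarith [mul_nonneg hE hc.le]
  refine ⟨first, ?_⟩
  rcases le_or_gt |B| |A| with hAB | hAB
  · rcases eq_or_ne A 0 with rfl | hA
    · rw [abs_zero, mul_zero]; positivity
    · have hA' := abs_pos.2 hA
      calc _ ≤ (∑ j ∈ J, 3990532 * E * (|B| / |A|) * min (2 ^ j * |A|) (2 ^ j * |A|)⁻¹) * |A| := by
            gcongr with j hj
            exact h.abs_dyadicPiece_le_of_abs_le (hJ j hj) hA hAB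
        _ = 3990532 * E * (∑ j ∈ J, min (2 ^ j * |A|) (2 ^ j * |A|)⁻¹) * |B| := by
            rw [← Finset.mul_sum]; field_simp
        _ ≤ 3990532 * E * c * |B| := by
            gcongr
            exact H id Function.injective_id |A| hA'.le J
        _ ≤ _ := by nlinarith [abs_nonneg B]
  · calc _ ≤ (3990532 * E * c + 1) * |A| := by gcongr
      _ ≤ _ := by gcongr

end IsBump

namespace CutoffFun

variable {η₀ : ℝ → ℝ}

theorem contDiff_etad (h : CutoffFun η₀) : ContDiff ℝ (⊤ : ℕ∞) (etad η₀) := by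
  have := h.smooth
  unfold etad
  fun_prop

theorem continuous_etad (h : CutoffFun η₀) : Continuous (etad η₀) := h.contDiff_etad.continuous

theorem etad_neg (h : CutoffFun η₀) (s : ℝ) : etad η₀ (-s) = etad η₀ s := by
  simp only [etad, neg_div, h.even]

theorem etad_abs (h : CutoffFun η₀) (s : ℝ) : etad η₀ |s| = etad η₀ s := by
  rcases abs_choice s with e | e <;> rw [e]
  exact h.etad_neg s

theorem etad_eq_zero_of_le (h : CutoffFun η₀) {s : ℝ} (hs : |s| ≤ 1 / 2) : etad η₀ s = 0 := by
  rw [etad, h.eq_one s hs, h.eq_one (s / 2), sub_self]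
  rw [abs_div, abs_two]
  linarith [abs_nonneg s]

theorem etad_eq_zero_of_ge (h : CutoffFun η₀) {s : ℝ} (hs : 3 / 2 ≤ |s|) : etad η₀ s = 0 := by
  rw [etad, h.eq_zero s (by linarith), h.eq_zero (s / 2), sub_self]
  rw [abs_div, abs_two]
  linarith

theorem abs_etad_le_one (h : CutoffFun η₀) (s : ℝ) : |etad η₀ s| ≤ 1 := by
  obtain ⟨a, b⟩ := h.mem01 s
  obtain ⟨c, d⟩ := h.mem01 (s / 2)
  rw [etad, abs_le]
  constructor <;> linarith

theorem abs_etad_le (h : CutoffFun η₀) (s : ℝ) : |etad η₀ s| ≤ 2 * min |s| |s|⁻¹ := by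
  have h0 : 0 ≤ 2 * min |s| |s|⁻¹ := by positivity
  rcases le_or_gt |s| (1 / 2) with h1 | h1
  · rwa [h.etad_eq_zero_of_le h1, abs_zero]
  rcases le_or_gt (3 / 2) |s| with h2 | h2
  · rwa [h.etad_eq_zero_of_ge h2, abs_zero]
  refine (h.abs_etad_le_one s).trans ?_
  rw [mul_min_of_nonneg _ _ (by norm_num)]
  apply le_min
  · linarith
  · rw [← div_eq_mul_inv, le_div_iff₀ (by linarith)]
    linarith

theorem hasCompactSupport_etad (h : CutoffFun η₀) : HasCompactSupport (etad η₀) :=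
  HasCompactSupport.intro (isCompact_Icc (a := -(3 / 2 : ℝ)) (b := 3 / 2)) fun s hs =>
    h.etad_eq_zero_of_ge (by
      rw [Set.mem_Icc, ← abs_le] at hs
      linarith)

theorem exists_isBump (h : CutoffFun η₀) :
    ∃ E, IsBump (etad η₀) (deriv (etad η₀)) (deriv (deriv (etad η₀))) E := by
  have c0 := h.contDiff_etad
  have c1 : ContDiff ℝ (⊤ : ℕ∞) (deriv (etad η₀)) := c0.deriv'
  have c2 : ContDiff ℝ (⊤ : ℕ∞) (deriv (deriv (etad η₀))) := c1.deriv'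
  have k0 := h.hasCompactSupport_etad
  obtain ⟨E₀, hE₀⟩ := k0.exists_bound_of_continuous c0.continuous
  obtain ⟨E₁, hE₁⟩ := k0.deriv.exists_bound_of_continuous c1.continuous
  obtain ⟨E₂, hE₂⟩ := k0.deriv.deriv.exists_bound_of_continuous c2.continuous
  have cl : IsClosed {x | deriv (etad η₀) x = 0} := isClosed_eq c1.continuous continuous_const
  have z1 : closure (Set.Ioo (0 : ℝ) (1 / 2)) ⊆ {x | deriv (etad η₀) x = 0} := by
    rw [cl.closure_subset_iff]
    intro x hx
    have : etad η₀ =ᶠ[nhds x] fun _ => 0 := by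
      filter_upwards [Ioo_mem_nhds hx.1 hx.2] with y hy
      exact h.etad_eq_zero_of_le (by rw [abs_of_pos hy.1]; exact hy.2.le)
    simpa using this.deriv_eq
  have z2 : closure (Set.Ioi (3 / 2 : ℝ)) ⊆ {x | deriv (etad η₀) x = 0} := by
    rw [cl.closure_subset_iff]
    intro x hx
    have : etad η₀ =ᶠ[nhds x] fun _ => 0 := by
      filter_upwards [Ioi_mem_nhds hx] with y hy
      exact h.etad_eq_zero_of_ge (le_trans (le_of_lt hy) (le_abs_self y))
    simpa using this.deriv_eq
  rw [closure_Ioo (by norm_num)] at z1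
  rw [closure_Ioi] at z2
  exact ⟨max E₀ (max E₁ E₂),
    { hasDerivAt := fun t => (c0.differentiable (by simp) t).hasDerivAt
      hasDerivAt' := fun t => (c1.differentiable (by simp) t).hasDerivAt
      cont := c2.continuous
      left := h.etad_eq_zero_of_le (by norm_num [abs_le])
      right := h.etad_eq_zero_of_ge (le_abs_self _)
      left' := z1 (by norm_num)
      right' := z2 (by norm_num)
      le := fun t => (hE₀ t).trans (le_max_left _ _)
      le' := fun t => (hE₁ t).trans ((le_max_left _ _).trans (le_max_right _ _))
      le'' := fun t => (hE₂ t).trans ((le_max_right _ _).trans (le_max_right _ _)) }⟩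

end CutoffFun

theorem one_le_bet (s : ℝ) : 1 ≤ bet s := by
  apply Real.le_sqrt_of_sq_le
  nlinarith [sq_nonneg s]

theorem continuous_bet : Continuous bet := by
  unfold bet; fun_prop

theorem bet_zpow_mul (j : ℤ) (t : ℝ) : bet (2 ^ j * t) = 2 ^ j * scaledBet (2 ^ (-j)) t := by
  have p0 : (0 : ℝ) < 2 ^ j := by positivity
  rw [bet, scaledBet, ← Real.sqrt_sq p0.le, ← Real.sqrt_mul (by positivity), Real.sqrt_sq p0.le,
    zpow_neg]
  congr 1
  field_simp

/-- The one-variable kernel `e(2⁻ʲs) β(s)⁻¹ sin (β(s)B)`. -/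
def baseKer (e : ℝ → ℝ) (j : ℤ) (B s : ℝ) : ℝ :=
  e (2 ^ (-j) * s) / bet s * Real.sin (bet s * B)

theorem continuous_baseKer {e : ℝ → ℝ} (he : Continuous e) (j : ℤ) :
    Continuous fun z : ℝ × ℝ => baseKer e j z.1 z.2 := by
  have := continuous_bet
  unfold baseKer
  refine Continuous.mul (Continuous.div (by fun_prop) (by fun_prop) fun z => ?_) (by fun_prop)
  linarith [one_le_bet z.2]

theorem CutoffFun.baseKer_eq_zero {η₀ : ℝ → ℝ} (h : CutoffFun η₀) {j : ℤ} {B s : ℝ}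
    (hs : 3 / 2 * 2 ^ j ≤ |s|) : baseKer (etad η₀) j B s = 0 := by
  have p0 : (0 : ℝ) < 2 ^ j := by positivity
  rw [baseKer, h.etad_eq_zero_of_ge, zero_div, zero_mul]
  rw [abs_mul, zpow_neg, abs_of_pos (by positivity : (0 : ℝ) < (2 ^ j)⁻¹), inv_mul_eq_div,
    le_div_iff₀ p0]
  exact hs

/-- The Fourier transform of the one-variable kernel is a dyadic piece. -/
theorem CutoffFun.integral_baseKer_mul_cexp {η₀ : ℝ → ℝ} (h : CutoffFun η₀) (j : ℤ) (A B : ℝ) :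
    ∫ s : ℝ, (baseKer (etad η₀) j B s : ℂ) * Complex.exp (Complex.I * (s * A : ℝ)) =
      2 * dyadicPiece (etad η₀) j A B := by
  set F : ℝ → ℂ := fun s =>
    (baseKer (etad η₀) j B s : ℂ) * Complex.exp (Complex.I * (s * A : ℝ)) with hF
  have p0 : (0 : ℝ) < 2 ^ j := by positivity
  have cb : Continuous (baseKer (etad η₀) j B) :=
    (continuous_baseKer h.continuous_etad j).comp (Continuous.prodMk_right B)
  have cF : Continuous F := by fun_prop
  have sF : HasCompactSupport F :=
    HasCompactSupport.intro (isCompact_Icc (a := -(3 / 2 * 2 ^ j : ℝ)) (b := 3 / 2 * 2 ^ j))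
      fun s hs => by
        rw [Set.mem_Icc, ← abs_le] at hs
        simp only [hF, h.baseKer_eq_zero (not_le.1 hs).le, Complex.ofReal_zero, zero_mul]
  have iF : Integrable F := cF.integrable_of_hasCompactSupport sF
  have even : ∀ s, baseKer (etad η₀) j B (-s) = baseKer (etad η₀) j B s := fun s => by
    simp only [baseKer, bet, mul_neg, h.etad_neg, neg_sq]
  have e1 : ∫ s, F s = ((∫ s, baseKer (etad η₀) j B s * Real.cos (s * A) : ℝ) : ℂ) := by
    have : (∫ s, F s) + ∫ s, F s =
        2 * ((∫ s, baseKer (etad η₀) j B s * Real.cos (s * A) : ℝ) : ℂ) := by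
      nth_rewrite 2 [← integral_neg_eq_self]
      rw [← integral_add iF iF.comp_neg, ← integral_complex_ofReal, ← integral_const_mul]
      congr 1
      ext s
      simp only [hF, even]
      rw [← mul_add]
      push_cast
      rw [Complex.cos]
      ring_nf
    linear_combination this / 2
  have e2 : ∫ s, baseKer (etad η₀) j B s * Real.cos (s * A) =
      2 * dyadicPiece (etad η₀) j A B := by
    have h1 := Measure.integral_comp_mul_left
      (fun s => baseKer (etad η₀) j B s * Real.cos (s * A)) ((2 : ℝ) ^ j)
    rw [abs_of_pos (by positivity), smul_eq_mul, inv_mul_eq_div, eq_div_iff p0.ne'] at h1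
    rw [← h1, mul_comm, ← integral_const_mul]
    have h2 : ∀ t, 2 ^ j * (baseKer (etad η₀) j B (2 ^ j * t) * Real.cos (2 ^ j * t * A)) =
        (fun t => etad η₀ t / scaledBet (2 ^ (-j)) t * Real.cos (t * (2 ^ j * A)) *
          Real.sin (scaledBet (2 ^ (-j)) t * (2 ^ j * B))) |t| := by
      intro t
      have q1 : (2 : ℝ) ^ (-j) * (2 ^ j * t) = t := by
        rw [zpow_neg]; field_simp
      have q2 : scaledBet (2 ^ (-j)) |t| = scaledBet (2 ^ (-j)) t := by
        simp only [scaledBet, sq_abs]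
      have q3 : Real.cos (|t| * (2 ^ j * A)) = Real.cos (2 ^ j * t * A) := by
        rcases abs_choice t with e | e <;> rw [e]
        · ring_nf
        · rw [neg_mul, Real.cos_neg]; ring_nf
      simp only [q2, q3, h.etad_abs, baseKer, q1, bet_zpow_mul]

      rw [div_mul_eq_div_div_swap, mul_left_comm (scaledBet _ t), ← mul_assoc _ _ B]
      generalize etad η₀ t / scaledBet (2 ^ (-j)) t = x
      field_simp
    refine (integral_congr_ae (Filter.Eventually.of_forall h2)).trans ?_
    refine (integral_comp_abs (f := fun t => etad η₀ t / scaledBet (2 ^ (-j)) t *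
      Real.cos (t * (2 ^ j * A)) * Real.sin (scaledBet (2 ^ (-j)) t * (2 ^ j * B)))).trans ?_
    rw [dyadicPiece, intervalIntegral.integral_of_le (by norm_num)]
    congr 1
    apply setIntegral_eq_of_subset_of_forall_sdiff_eq_zero measurableSet_Ioi
    · intro t ht; exact lt_trans (by norm_num) ht.1
    · intro t ht
      have ht0 : 0 < t := ht.1
      have : etad η₀ t = 0 := by
        by_cases h3 : t ≤ 1 / 2
        · exact h.etad_eq_zero_of_le (by rwa [abs_of_pos ht0])
        · apply h.etad_eq_zero_of_ge
          rw [abs_of_pos ht0]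
          by_contra h4
          exact ht.2 ⟨not_le.1 h3, (not_le.1 h4).le⟩
      simp [this]
  rw [e1, e2]
  push_cast
  rfl

/-- The Fourier transform of `v` in its first variable. -/
def partialFourier (v : ℝ × ℝ → ℂ) (ξ Y : ℝ) : ℂ :=
  ∫ x, v (x, Y) * Complex.exp (Complex.I * (x * -(2 * Real.pi * ξ) : ℝ))

open FourierTransform in
theorem partialFourier_eq (v : ℝ × ℝ → ℂ) (ξ Y : ℝ) :
    partialFourier v ξ Y = 𝓕 (fun x => v (x, Y)) ξ := by
  rw [Real.fourier_real_eq_integral_exp_smul, partialFourier]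
  congr 1
  ext x
  rw [smul_eq_mul, mul_comm, mul_comm Complex.I]
  congr 4
  ring

theorem continuous_partialFourier {v : ℝ × ℝ → ℂ} (hv : Continuous v) {R : ℝ}
    (hR : ∀ x Y, R < |x| → v (x, Y) = 0) :
    Continuous fun z : ℝ × ℝ => partialFourier v z.1 z.2 := by
  have e : (fun z : ℝ × ℝ => partialFourier v z.1 z.2) = fun z : ℝ × ℝ =>
      ∫ x in Set.Icc (-R) R,
        v (x, z.2) * Complex.exp (Complex.I * (x * -(2 * Real.pi * z.1) : ℝ)) := by
    ext z
    symm
    apply setIntegral_eq_integral_of_forall_compl_eq_zero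
    intro x hx
    rw [Set.mem_Icc, ← abs_le] at hx
    rw [hR x z.2 (not_le.1 hx), zero_mul]
  rw [e]
  apply continuous_parametric_integral_of_continuous _ isCompact_Icc
  unfold Function.uncurry
  fun_prop

theorem lintegral_enorm_sq_partialFourier {v : ℝ × ℝ → ℂ} (hv : Continuous v) {R : ℝ}
    (hR : ∀ x Y, R < |x| → v (x, Y) = 0) :
    ∫⁻ ξ, ∫⁻ Y, ‖partialFourier v ξ Y‖ₑ ^ 2 = ∫⁻ z, ‖v z‖ₑ ^ 2 := by
  have c := (continuous_partialFourier hv hR).measurable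
  rw [lintegral_lintegral_swap (by fun_prop), Measure.volume_eq_prod,
    lintegral_prod_symm _ (by fun_prop)]
  congr 1
  ext Y
  have cv : Continuous fun x => v (x, Y) := by fun_prop
  have sv : HasCompactSupport fun x => v (x, Y) :=
    HasCompactSupport.intro (isCompact_Icc (a := -R) (b := R)) fun x hx => by
      rw [Set.mem_Icc, ← abs_le] at hx
      exact hR x Y (not_le.1 hx)
  simp only [partialFourier_eq]
  exact lintegral_enorm_sq_fourier (cv.integrable_of_hasCompactSupport sv)
    (cv.memLp_of_hasCompactSupport sv)

theorem hilbertKernel_nonneg (x₀ x y : ℝ) : 0 ≤ hilbertKernel x₀ x y := by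
  unfold hilbertKernel; positivity

theorem measurable_hilbertKernel (x₀ : ℝ) :
    Measurable fun p : ℝ × ℝ => ENNReal.ofReal (hilbertKernel x₀ p.1 p.2) := by
  unfold hilbertKernel
  fun_prop

theorem lintegral_sq_lintegral_add_hilbertKernel_le (x₀ x₁ : ℝ) {D : ℝ} (hD : 0 ≤ D)
    {f : ℝ → ENNReal} (hf : Measurable f) :
    ∫⁻ x, (∫⁻ y, ENNReal.ofReal (D * (hilbertKernel x₀ x y + hilbertKernel x₁ x y)) * f y) ^ 2 ≤
      ENNReal.ofReal (1024 * D ^ 2) * ∫⁻ y, f y ^ 2 := by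
  set a : ℝ → ℝ → ENNReal := fun z x => ∫⁻ y, ENNReal.ofReal (hilbertKernel z x y) * f y with ha
  have ma : ∀ z, Measurable (a z) := fun z =>
    ((measurable_hilbertKernel z).mul (hf.comp measurable_snd)).lintegral_prod_right'
  have e1 : ∀ x, (∫⁻ y, ENNReal.ofReal (D * (hilbertKernel x₀ x y + hilbertKernel x₁ x y)) * f y) =
      ENNReal.ofReal D * (a x₀ x + a x₁ x) := by
    intro x
    have m : ∀ z, Measurable fun y => ENNReal.ofReal (hilbertKernel z x y) * f y := fun z =>
      ((measurable_hilbertKernel z).comp measurable_prodMk_left).mul hf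
    have m0 := m x₀
    have m1 := m x₁
    rw [ha, ← lintegral_add_left (m _), ← lintegral_const_mul _ (by fun_prop)]
    congr 1
    ext y
    rw [ENNReal.ofReal_mul hD, ENNReal.ofReal_add (hilbertKernel_nonneg _ _ _)
      (hilbertKernel_nonneg _ _ _)]
    ring
  simp only [e1]
  calc _ ≤ ∫⁻ x, ENNReal.ofReal D ^ 2 * (2 * (a x₀ x ^ 2 + a x₁ x ^ 2)) := by
        gcongr with x
        rw [mul_pow]
        gcongr
        have := ENNReal.rpow_add_le_mul_rpow_add_rpow (a x₀ x) (a x₁ x) (p := 2) (by norm_num)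
        norm_num at this
        exact this
    _ = ENNReal.ofReal D ^ 2 * (2 * ((∫⁻ x, a x₀ x ^ 2) + ∫⁻ x, a x₁ x ^ 2)) := by
        have m0 := (ma x₀).pow_const 2
        have m1 := (ma x₁).pow_const 2
        rw [lintegral_const_mul _ (by fun_prop), lintegral_const_mul _ (by fun_prop),
          lintegral_add_left m0]
    _ ≤ ENNReal.ofReal D ^ 2 * (2 * (16 ^ 2 * (∫⁻ y, f y ^ 2) + 16 ^ 2 * ∫⁻ y, f y ^ 2)) := by
        gcongr
        · exact lintegral_sq_lintegral_hilbertKernel_le x₀ hf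
        · exact lintegral_sq_lintegral_hilbertKernel_le x₁ hf
    _ = _ := by
        rw [ENNReal.ofReal_mul (by norm_num), ENNReal.ofReal_pow hD]
        norm_num
        ring

/-- An `L²` bound for operators of convolution type in the first variable, whose partial Fourier
multipliers are dominated by a sum of two Hilbert kernels. -/
theorem lintegral_enorm_sq_integral_le {L : ℝ → ℝ → ℝ → ℂ}
    (hL : Continuous fun z : ℝ × ℝ × ℝ => L z.1 z.2.1 z.2.2) {R : ℝ}
    (hR : ∀ s X Y, R < |s| → L s X Y = 0) {g : ℝ × ℝ → ℂ} (hg : Continuous g)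
    (hgc : HasCompactSupport g) {D : ℝ} (hD : 0 ≤ D) (x₀ : ℝ → ℝ)
    (hK : ∀ ξ X Y, ‖∫ s, L s X Y * Complex.exp (Complex.I * (s * -(2 * Real.pi * ξ) : ℝ))‖ ≤
      D * (hilbertKernel 0 X Y + hilbertKernel (x₀ ξ) X Y)) :
    ∫⁻ x : ℝ × ℝ, ‖∫ y : ℝ × ℝ, L (x.1 - y.1) x.2 y.2 * g y‖ₑ ^ 2 ≤
      ENNReal.ofReal (1024 * D ^ 2) * ∫⁻ y, ‖g y‖ₑ ^ 2 := by
  obtain ⟨r, hr⟩ := hgc.isCompact.isBounded.subset_closedBall 0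
  have gz : ∀ y : ℝ × ℝ, r < |y.1| → g y = 0 := by
    intro y hy
    by_contra h
    have h1 := hr (subset_tsupport g h)
    rw [mem_closedBall_zero_iff] at h1
    have := norm_fst_le y
    rw [Real.norm_eq_abs] at this
    linarith
  set u : ℝ × ℝ → ℂ := fun x => ∫ y : ℝ × ℝ, L (x.1 - y.1) x.2 y.2 * g y with hu
  have cL : Continuous fun z : (ℝ × ℝ) × (ℝ × ℝ) => L (z.1.1 - z.2.1) z.1.2 z.2.2 :=
    hL.comp (f := fun z : (ℝ × ℝ) × (ℝ × ℝ) => (z.1.1 - z.2.1, z.1.2, z.2.2)) (by fun_prop)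
  have cu : Continuous u := by
    have e : u = fun x => ∫ y in tsupport g, L (x.1 - y.1) x.2 y.2 * g y := by
      ext x
      symm
      apply setIntegral_eq_integral_of_forall_compl_eq_zero
      intro y hy
      rw [image_eq_zero_of_notMem_tsupport hy, mul_zero]
    rw [e]
    apply continuous_parametric_integral_of_continuous _ hgc.isCompact
    exact cL.mul (hg.comp continuous_snd)
  have zero : ∀ x X : ℝ, ∀ y : ℝ × ℝ, R + r < |x| → L (x - y.1) X y.2 * g y = 0 := by
    intro x X y hx
    rcases le_or_gt |y.1| r with h | h
    · rw [hR, zero_mul]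
      have := abs_sub_abs_le_abs_sub x y.1
      linarith
    · rw [gz y h, mul_zero]
  have zu : ∀ x X, R + r < |x| → u (x, X) = 0 := by
    intro x X hx
    simp only [hu, zero x X _ hx, integral_zero]
  have key : ∀ ξ X, partialFourier u ξ X =
      ∫ Y, partialFourier (fun z => L z.1 X z.2) ξ Y * partialFourier g ξ Y := by
    intro ξ X
    set ψ : ℝ → ℂ := fun x => Complex.exp (Complex.I * (x * -(2 * Real.pi * ξ) : ℝ)) with hψ
    have cψ : Continuous ψ := by fun_prop
    have ψa : ∀ a b, ψ (a + b) = ψ a * ψ b := by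
      intro a b
      simp only [hψ, ← Complex.exp_add]
      congr 1
      push_cast
      ring
    have cK : Continuous fun Y => partialFourier (fun z => L z.1 X z.2) ξ Y :=
      (continuous_partialFourier (v := fun z => L z.1 X z.2)
        (hL.comp (f := fun z : ℝ × ℝ => (z.1, X, z.2)) (by fun_prop)) (R := R)
        (fun x Y hx => hR x X Y hx)).comp (Continuous.prodMk_right ξ)
    calc partialFourier u ξ X
        = ∫ x, ∫ y : ℝ × ℝ, L (x - y.1) X y.2 * g y * ψ x := by
          simp only [partialFourier, hu, ← integral_mul_const, hψ]
      _ = ∫ y : ℝ × ℝ, ∫ x, L (x - y.1) X y.2 * g y * ψ x := by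
          apply integral_integral_swap_of_hasCompactSupport
          · have : Continuous fun z : ℝ × (ℝ × ℝ) => L (z.1 - z.2.1) X z.2.2 :=
              hL.comp (f := fun z : ℝ × (ℝ × ℝ) => (z.1 - z.2.1, X, z.2.2)) (by fun_prop)
            unfold Function.uncurry
            fun_prop
          · refine HasCompactSupport.intro
              (isCompact_Icc (a := -(R + r)) (b := R + r) |>.prod hgc.isCompact) ?_
            rintro ⟨x, y⟩ hxy
            simp only [Function.uncurry]
            by_cases hx : x ∈ Set.Icc (-(R + r)) (R + r)
            · have hy : y ∉ tsupport g := fun hy => hxy ⟨hx, hy⟩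
              rw [image_eq_zero_of_notMem_tsupport hy, mul_zero, zero_mul]
            · rw [Set.mem_Icc, ← abs_le] at hx
              rw [zero x X y (not_le.1 hx), zero_mul]
      _ = ∫ y : ℝ × ℝ, partialFourier (fun z => L z.1 X z.2) ξ y.2 * (g y * ψ y.1) := by
          congr 1
          ext y
          rw [← integral_add_right_eq_self _ y.1, partialFourier, ← integral_mul_const]
          congr 1
          ext x
          rw [add_sub_cancel_right, ψa]
          ring
      _ = ∫ Y, ∫ x, partialFourier (fun z => L z.1 X z.2) ξ Y * (g (x, Y) * ψ x) := by
          rw [Measure.volume_eq_prod, integral_prod_symm]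
          rw [← Measure.volume_eq_prod]
          apply Continuous.integrable_of_hasCompactSupport
          · have := cK.comp continuous_snd (X := ℝ × ℝ)
            fun_prop
          · exact (hgc.mul_right).mul_left
      _ = _ := by
          simp only [integral_const_mul]
          rfl
  rw [← lintegral_enorm_sq_partialFourier cu zu,
    ← lintegral_enorm_sq_partialFourier hg (R := r) (fun x Y hx => gz (x, Y) hx)]
  have mF := (continuous_partialFourier hg (R := r) (fun x Y hx => gz (x, Y) hx)).measurable
  calc _ ≤ ∫⁻ ξ, ENNReal.ofReal (1024 * D ^ 2) * ∫⁻ Y, ‖partialFourier g ξ Y‖ₑ ^ 2 := by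
        gcongr with ξ
        refine le_trans ?_ (lintegral_sq_lintegral_add_hilbertKernel_le 0 (x₀ ξ) hD
          (f := fun Y => ‖partialFourier g ξ Y‖ₑ) (mF.comp measurable_prodMk_left).enorm)
        gcongr with X
        rw [key]
        refine (enorm_integral_le_lintegral_enorm _).trans ?_
        gcongr with Y
        rw [enorm_mul]
        gcongr
        rw [← ofReal_norm]
        exact ENNReal.ofReal_le_ofReal (hK ξ X Y)
    _ = _ := by
        rw [lintegral_const_mul]
        exact (mF.enorm.pow_const 2).lintegral_prod_right'

theorem le_hilbertKernel_add {k C γ ζ X Y : ℝ} (hk : 0 ≤ k) (hC : 0 ≤ C) (hγ : 1 / 2 ≤ |γ|)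
    (h0 : X = Y → k = 0) (h1 : k * |X - Y| ≤ C)
    (h2 : k * |γ * (X ^ 2 + Y ^ 2) - 2 * ζ| ≤ C * |X + Y|) :
    k ≤ 4 * C * (hilbertKernel 0 X Y + hilbertKernel (√(ζ / γ)) X Y) := by
  have hH := hilbertKernel_nonneg
  rcases eq_or_ne X Y with rfl | hXY
  · rw [h0 rfl]
    have := hH 0 X X
    have := hH (√(ζ / γ)) X X
    positivity
  have of_le : ∀ x₀, 0 < |(|X| - x₀)| + |(|Y| - x₀)| →
      k * (|(|X| - x₀)| + |(|Y| - x₀)|) ≤ 4 * C → k ≤ 4 * C * hilbertKernel x₀ X Y := by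
    intro x₀ hp h
    rwa [hilbertKernel, mul_one_div, le_div_iff₀ hp]
  rcases le_or_gt (X * Y) 0 with hs | hs
  · have e : |X - Y| = |X| + |Y| := by
      rw [sub_eq_add_neg, abs_add_eq_add_abs_iff _ _ |>.2, abs_neg]
      rcases mul_nonpos_iff.1 hs with h | h
      · exact Or.inl ⟨h.1, neg_nonneg.2 h.2⟩
      · exact Or.inr ⟨h.1, neg_nonpos.2 h.2⟩
    have hp := abs_pos.2 (sub_ne_zero.2 hXY)
    rw [e] at h1 hp
    have := of_le 0 (by simpa using hp) (by simp only [sub_zero, abs_abs]; linarith)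
    nlinarith [hH (√(ζ / γ)) X Y]
  · set x₀ := √(ζ / γ) with hx₀
    have hx0 : 0 ≤ x₀ := Real.sqrt_nonneg _
    have hγ0 : γ ≠ 0 := by rintro rfl; norm_num at hγ
    have e1 : |X ^ 2 + Y ^ 2 - 2 * x₀ ^ 2| ≤ |X ^ 2 + Y ^ 2 - 2 * (ζ / γ)| := by
      rcases le_or_gt 0 (ζ / γ) with h | h
      · rw [hx₀, Real.sq_sqrt h]
      · rw [hx₀, Real.sqrt_eq_zero_of_nonpos h.le, zero_pow two_ne_zero, mul_zero, sub_zero,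
          abs_of_nonneg (by positivity)]
        refine le_trans ?_ (le_abs_self _)
        linarith
    have e2 : γ * (X ^ 2 + Y ^ 2) - 2 * ζ = γ * (X ^ 2 + Y ^ 2 - 2 * (ζ / γ)) := by
      field_simp
    have h3 : k * |X ^ 2 + Y ^ 2 - 2 * x₀ ^ 2| ≤ 2 * C * |X + Y| := by
      rw [e2, abs_mul] at h2
      have : 1 / 2 * |X ^ 2 + Y ^ 2 - 2 * x₀ ^ 2| ≤ |γ| * |X ^ 2 + Y ^ 2 - 2 * (ζ / γ)| := by
        gcongr
      nlinarith [mul_le_mul_of_nonneg_left this hk]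
    have hX : X ≠ 0 := left_ne_zero_of_mul hs.ne'
    have hY : Y ≠ 0 := right_ne_zero_of_mul hs.ne'
    have e3 : |X + Y| = |X| + |Y| := by
      rw [abs_add_eq_add_abs_iff]
      rcases mul_pos_iff.1 hs with h | h
      · exact Or.inl ⟨h.1.le, h.2.le⟩
      · exact Or.inr ⟨h.1.le, h.2.le⟩
    have e4 : |X - Y| = |(|X| - |Y|)| := by
      rcases mul_pos_iff.1 hs with h | h
      · rw [abs_of_pos h.1, abs_of_pos h.2]
      · rw [abs_of_neg h.1, abs_of_neg h.2, ← abs_neg]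
        ring_nf
    have hab : 0 < |(|X| - |Y|)| := by rw [← e4]; exact abs_pos.2 (sub_ne_zero.2 hXY)
    rw [← sq_abs X, ← sq_abs Y, e3] at h3
    rw [e4] at h1
    have ha := abs_pos.2 hX
    have hb := abs_pos.2 hY
    suffices k ≤ 4 * C * hilbertKernel x₀ X Y by nlinarith [hH 0 X Y]
    have tri := abs_sub_le |X| x₀ |Y|
    rw [abs_sub_comm x₀] at tri
    apply of_le x₀ (by linarith)
    generalize |X| = a at *
    generalize |Y| = b at *
    have fin : ∀ w, 1 / 2 * w * (a + b) ≤ |a ^ 2 + b ^ 2 - 2 * x₀ ^ 2| → k * w ≤ 4 * C := by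
      intro w hw
      have := mul_le_mul_of_nonneg_left hw hk
      have h5 : k * w * (a + b) ≤ 4 * C * (a + b) := by linarith
      exact le_of_mul_le_mul_right h5 (by linarith)
    rcases le_total x₀ a with h | h <;> rcases le_total x₀ b with h' | h'
    · apply fin
      rw [abs_of_nonneg (sub_nonneg.2 h), abs_of_nonneg (sub_nonneg.2 h')]
      refine le_trans ?_ (le_abs_self _)
      nlinarith [sq_nonneg (a - b)]
    · rw [abs_of_nonneg (sub_nonneg.2 h), abs_of_nonpos (sub_nonpos.2 h')]
      rw [abs_of_nonneg (by linarith)] at h1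
      nlinarith
    · rw [abs_of_nonpos (sub_nonpos.2 h), abs_of_nonneg (sub_nonneg.2 h')]
      rw [abs_of_nonpos (by linarith)] at h1
      nlinarith
    · apply fin
      rw [abs_of_nonpos (sub_nonpos.2 h), abs_of_nonpos (sub_nonpos.2 h')]
      refine le_trans ?_ (neg_le_abs _)
      nlinarith [mul_nonneg (sub_nonneg.2 h) (sub_nonneg.2 h')]

theorem CutoffFun.continuous_etad_div {η₀ : ℝ → ℝ} (h : CutoffFun η₀) (j : ℤ) :
    Continuous fun u => etad η₀ (2 ^ (-j) * u) / u := by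
  have c := h.continuous_etad
  rw [continuous_iff_continuousAt]
  intro u
  rcases eq_or_ne u 0 with rfl | hu
  · have c' : Continuous fun u : ℝ => |2 ^ (-j) * u| := by fun_prop
    have : (fun u => etad η₀ (2 ^ (-j) * u) / u) =ᶠ[nhds 0] fun _ => 0 := by
      filter_upwards [c'.continuousAt.eventually_lt (continuousAt_const (y := (1 / 2 : ℝ)))
        (by norm_num)] with u hu
      rw [h.etad_eq_zero_of_le hu.le, zero_div]
    exact (continuousAt_const (y := (0 : ℝ))).congr this.symm
  · exact (Continuous.continuousAt (by fun_prop)).div continuousAt_id hu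

/-- The kernel of the operator after removal of the modulations. -/
def reducedKer (η₀ : ℝ → ℝ) (γ : ℝ) (j : ℤ × ℤ) (s X Y : ℝ) : ℂ :=
  ((etad η₀ (2 ^ (-j.2) * (X - Y)) / (X - Y) *
      baseKer (etad η₀) j.1 (|X + Y| * (X - Y)) s : ℝ) : ℂ) *
    Complex.exp (Complex.I * (γ * (s * (X ^ 2 + Y ^ 2)) : ℝ))

namespace CutoffFun

variable {η₀ : ℝ → ℝ}

theorem continuous_reducedKer (h : CutoffFun η₀) (γ : ℝ) (j : ℤ × ℤ) :
    Continuous fun z : ℝ × ℝ × ℝ => reducedKer η₀ γ j z.1 z.2.1 z.2.2 := by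
  have c1 := (h.continuous_etad_div j.2).comp
    (f := fun z : ℝ × ℝ × ℝ => z.2.1 - z.2.2) (by fun_prop)
  have c2 := (continuous_baseKer h.continuous_etad j.1).comp
    (f := fun z : ℝ × ℝ × ℝ => (|z.2.1 + z.2.2| * (z.2.1 - z.2.2), z.1)) (by fun_prop)
  simp only [Function.comp_def] at c1 c2
  unfold reducedKer
  fun_prop

theorem reducedKer_eq_zero (h : CutoffFun η₀) {γ : ℝ} {j : ℤ × ℤ} {s X Y : ℝ}
    (hs : 3 / 2 * 2 ^ j.1 ≤ |s|) : reducedKer η₀ γ j s X Y = 0 := by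
  rw [reducedKer, h.baseKer_eq_zero hs]
  simp

theorem integral_reducedKer_mul_cexp (h : CutoffFun η₀) (γ : ℝ) (j : ℤ × ℤ) (t X Y : ℝ) :
    ∫ s, reducedKer η₀ γ j s X Y * Complex.exp (Complex.I * (s * -t : ℝ)) =
      ((etad η₀ (2 ^ (-j.2) * (X - Y)) / (X - Y) *
        (2 * dyadicPiece (etad η₀) j.1 (γ * (X ^ 2 + Y ^ 2) - t) (|X + Y| * (X - Y))) : ℝ) : ℂ) := by
  have := h.integral_baseKer_mul_cexp j.1 (γ * (X ^ 2 + Y ^ 2) - t) (|X + Y| * (X - Y))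
  push_cast at this ⊢
  rw [← this, ← integral_const_mul]
  congr 1
  ext s
  rw [reducedKer, mul_assoc, ← Complex.exp_add]
  push_cast
  rw [mul_assoc]
  congr 4
  ring

/-- The partial Fourier multipliers of the reduced kernel are dominated by Hilbert kernels. -/
theorem exists_norm_integral_reducedKer_le (h : CutoffFun η₀) :
    ∃ D : ℝ, 0 < D ∧ ∀ γ : ℝ, 1 / 2 ≤ |γ| → ∀ I : Finset (ℤ × ℤ), (∀ j ∈ I, 0 ≤ j.1) →
      ∀ ξ X Y : ℝ,
      ‖∫ s, (∑ j ∈ I, reducedKer η₀ γ j s X Y) *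
        Complex.exp (Complex.I * (s * -(2 * Real.pi * ξ) : ℝ))‖ ≤
      D * (hilbertKernel 0 X Y + hilbertKernel (√(Real.pi * ξ / γ)) X Y) := by
  obtain ⟨E, hE⟩ := h.exists_isBump
  obtain ⟨C, hC, H⟩ := hE.exists_sum_abs_dyadicPiece_le
  obtain ⟨c, hc, Hc⟩ := exists_sum_min_zpow_le
  refine ⟨4 * (4 * c * C), by positivity, fun γ hγ I hI ξ X Y => ?_⟩
  set A := γ * (X ^ 2 + Y ^ 2) - 2 * Real.pi * ξ with hA
  set B := |X + Y| * (X - Y) with hB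
  set J₁ := I.image Prod.fst with hJ₁
  set J₂ := I.image Prod.snd with hJ₂
  set S₁ := ∑ j ∈ J₁, |dyadicPiece (etad η₀) j A B| with hS₁
  set S₂ := ∑ j ∈ J₂, |etad η₀ (2 ^ (-j) * (X - Y)) / (X - Y)| with hS₂
  have hS₁0 : 0 ≤ S₁ := Finset.sum_nonneg fun _ _ => abs_nonneg _
  have hS₂0 : 0 ≤ S₂ := Finset.sum_nonneg fun _ _ => abs_nonneg _
  have hJ : ∀ j ∈ J₁, 0 ≤ j := by
    intro j hj
    obtain ⟨i, hi, rfl⟩ := Finset.mem_image.1 hj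
    exact hI i hi
  obtain ⟨H₁, H₂⟩ := H A B J₁ hJ
  have b₂ : S₂ * |X - Y| ≤ 2 * c := by
    rw [hS₂, Finset.sum_mul]
    calc _ ≤ ∑ j ∈ J₂, 2 * min (2 ^ (-j) * |X - Y|) (2 ^ (-j) * |X - Y|)⁻¹ := by
          refine Finset.sum_le_sum fun j _ => ?_
          have p0 : (0 : ℝ) < 2 ^ (-j) := by positivity
          have := h.abs_etad_le (2 ^ (-j) * (X - Y))
          rw [abs_mul (2 ^ (-j)) (X - Y), abs_of_pos p0] at this
          refine le_trans ?_ this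
          rw [abs_div]
          rcases eq_or_ne |X - Y| 0 with h0 | h0
          · rw [h0, mul_zero]
            positivity
          · rw [div_mul_cancel₀ _ h0]
      _ ≤ _ := by
          rw [← Finset.mul_sum]
          gcongr
          exact Hc (fun j => -j) neg_injective _ (abs_nonneg _) J₂
  have bound : ‖∫ s, (∑ j ∈ I, reducedKer η₀ γ j s X Y) *
        Complex.exp (Complex.I * (s * -(2 * Real.pi * ξ) : ℝ))‖ ≤ 2 * S₁ * S₂ := by
    simp only [Finset.sum_mul]
    rw [integral_finsetSum]
    · refine (norm_sum_le _ _).trans ?_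
      calc _ ≤ ∑ j ∈ J₁ ×ˢ J₂, 2 * (|dyadicPiece (etad η₀) j.1 A B| *
            |etad η₀ (2 ^ (-j.2) * (X - Y)) / (X - Y)|) := by
            refine (Finset.sum_le_sum_of_subset_of_nonneg Finset.subset_product
              fun _ _ _ => norm_nonneg _).trans (Finset.sum_le_sum fun j _ => ?_)
            rw [h.integral_reducedKer_mul_cexp, Complex.norm_real, Real.norm_eq_abs, abs_mul,
              abs_mul, abs_two]
            exact le_of_eq (by ring)
        _ = _ := by
            rw [← Finset.mul_sum, hS₁, hS₂, mul_assoc, Finset.sum_mul_sum, Finset.sum_product]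
    · intro j _
      have c' : Continuous fun s => reducedKer η₀ γ j s X Y :=
        (h.continuous_reducedKer γ j).comp (f := fun s : ℝ => (s, X, Y)) (by fun_prop)
      apply Continuous.integrable_of_hasCompactSupport (by fun_prop)
      refine HasCompactSupport.mul_right (HasCompactSupport.intro
        (isCompact_Icc (a := -(3 / 2 * 2 ^ j.1 : ℝ)) (b := 3 / 2 * 2 ^ j.1)) fun s hs => ?_)
      rw [Set.mem_Icc, ← abs_le] at hs
      exact h.reducedKer_eq_zero (not_le.1 hs).le
  refine bound.trans ?_
  apply le_hilbertKernel_add (by positivity) (by positivity) hγ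
  · rintro rfl
    simp [hS₂]
  · calc 2 * S₁ * S₂ * |X - Y| = 2 * S₁ * (S₂ * |X - Y|) := by ring
      _ ≤ 2 * C * (2 * c) := by gcongr
      _ = _ := by ring
  · rw [← mul_assoc, ← hA]
    rcases eq_or_ne X Y with rfl | hXY
    · have : S₂ = 0 := by simp [hS₂]
      rw [this]
      simp only [mul_zero, zero_mul]
      positivity
    have hp := abs_pos.2 (sub_ne_zero.2 hXY)
    apply le_of_mul_le_mul_right _ hp
    calc 2 * S₁ * S₂ * |A| * |X - Y| = 2 * (S₁ * |A|) * (S₂ * |X - Y|) := by ring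
      _ ≤ 2 * (C * |B|) * (2 * c) := by gcongr
      _ = _ := by rw [hB, abs_mul, abs_abs]; ring

end CutoffFun

/-- The phase `G` with `Ψ(x, y) = (x₁ - y₁)(X² + Y²) + G(x₁, X) - G(y₁, Y)`, where
`X = x₂ + α₁/2` and `Y = y₂ + α₁/2`. -/
def modPhase (α₀ α₁ x X : ℝ) : ℝ := -2 * α₁ * (x * X) + α₁ ^ 2 / 2 * x - α₀ * X

theorem Tker_eq (η₀ : ℝ → ℝ) (α₀ α₁ γ : ℝ) (j : ℤ × ℤ) (x y : ℝ × ℝ) :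
    Tker η₀ (Polynomial.C α₀ + Polynomial.C α₁ * Polynomial.X) γ j x y =
      Complex.exp (Complex.I * (γ * modPhase α₀ α₁ x.1 (x.2 + α₁ / 2) : ℝ)) *
        (reducedKer η₀ γ j (x.1 - y.1) (x.2 + α₁ / 2) (y.2 + α₁ / 2) *
          Complex.exp (Complex.I * (-(γ * modPhase α₀ α₁ y.1 (y.2 + α₁ / 2)) : ℝ))) := by
  have p0 : ∀ i : ℤ, (2 : ℝ) ^ i ≠ 0 := fun i => by positivity
  have e1 : x.2 + α₁ / 2 - (y.2 + α₁ / 2) = x.2 - y.2 := by ring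
  have e2 : x.2 + α₁ / 2 + (y.2 + α₁ / 2) = x.2 + y.2 + α₁ := by ring
  have e3 : theta (Polynomial.C α₀ + Polynomial.C α₁ * Polynomial.X) x y =
      bet (x.1 - y.1) * (|x.2 + y.2 + α₁| * (x.2 - y.2)) := by
    simp [theta, mul_assoc]
  have e4 : γ * Psi (Polynomial.C α₀ + Polynomial.C α₁ * Polynomial.X) x y =
      γ * modPhase α₀ α₁ x.1 (x.2 + α₁ / 2) +
        (γ * ((x.1 - y.1) * ((x.2 + α₁ / 2) ^ 2 + (y.2 + α₁ / 2) ^ 2)) +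
          -(γ * modPhase α₀ α₁ y.1 (y.2 + α₁ / 2))) := by
    simp only [Psi, modPhase, eval_add, eval_C, eval_mul, eval_X]
    ring
  have e5 : (2 : ℝ) ^ (-j.1 - j.2) * chi1 η₀ j.1 (x.1 - y.1) * chi2 η₀ j.2 (x.2 - y.2) =
      etad η₀ (2 ^ (-j.2) * (x.2 - y.2)) / (x.2 - y.2) *
        (etad η₀ (2 ^ (-j.1) * (x.1 - y.1)) / bet (x.1 - y.1)) := by
    have : (2 : ℝ) ^ (-j.1 - j.2) = (2 ^ j.1)⁻¹ * (2 ^ j.2)⁻¹ := by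
      rw [sub_eq_add_neg, zpow_add₀ two_ne_zero, zpow_neg, zpow_neg]
    rw [this, chi1, chi2, mul_div_assoc, mul_div_assoc]
    have h1 := p0 j.1
    have h2 := p0 j.2
    generalize etad η₀ (2 ^ (-j.2) * (x.2 - y.2)) / (x.2 - y.2) = u
    generalize etad η₀ (2 ^ (-j.1) * (x.1 - y.1)) / bet (x.1 - y.1) = v
    field_simp
  rw [Tker, e5, e4, Complex.ofReal_add, Complex.ofReal_add, mul_add, mul_add, Complex.exp_add,
    Complex.exp_add, reducedKer, e1, e2, e3, baseKer]
  push_cast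
  ring

theorem eLpNorm_two_sq {α : Type*} [MeasurableSpace α] (μ : Measure α) (h : α → ℂ) :
    eLpNorm h 2 μ ^ 2 = ∫⁻ x, ‖h x‖ₑ ^ 2 ∂μ := by
  have := eLpNorm_nnreal_pow_eq_lintegral (f := h) (μ := μ) (p := 2) (by norm_num)
  norm_num at this
  exact this

theorem norm_cexp_I_mul (t : ℝ) : ‖Complex.exp (Complex.I * (t : ℝ))‖ₑ = 1 := by
  rw [← ofReal_norm, mul_comm, Complex.norm_exp_ofReal_mul_I, ENNReal.ofReal_one]

theorem stmt7 (Γ : ℝ) (hΓ : 1 / 2 < Γ) (η₀ : ℝ → ℝ) (hη₀ : CutoffFun η₀) :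
    ∃ C > 0,
      ∀ γ : ℝ, 1 / 2 ≤ |γ| → |γ| ≤ Γ →
      ∀ α₀ α₁ : ℝ,
      ∀ I : Finset (ℤ × ℤ), (∀ j ∈ I, 10 ≤ j.1) →
      ∀ f : ℝ × ℝ → ℂ, ContDiff ℝ (⊤ : ℕ∞) f → HasCompactSupport f →
        eLpNorm
          (fun x => ∑ j ∈ I, ∫ y : ℝ × ℝ,
            Tker η₀ (Polynomial.C α₀ + Polynomial.C α₁ * Polynomial.X) γ j x y * f y)
          2 volume ≤ ENNReal.ofReal C * eLpNorm f 2 volume := by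
  obtain ⟨D, hD, H⟩ := hη₀.exists_norm_integral_reducedKer_le
  refine ⟨32 * D, by positivity, fun γ hγ _ α₀ α₁ I hI f hf hfc => ?_⟩
  set v : ℝ × ℝ := (0, α₁ / 2) with hv
  set L : ℝ → ℝ → ℝ → ℂ := fun s X Y => ∑ j ∈ I, reducedKer η₀ γ j s X Y with hL
  set g : ℝ × ℝ → ℂ := fun y =>
    Complex.exp (Complex.I * (-(γ * modPhase α₀ α₁ y.1 y.2) : ℝ)) * f (y - v) with hg
  have cf := hf.continuous
  have cg : Continuous g := by
    unfold g modPhase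
    fun_prop
  have sg : HasCompactSupport g := by
    have : HasCompactSupport fun y => f (y - v) :=
      hfc.comp_homeomorph (Homeomorph.subRight v)
    exact this.mul_left
  have main := lintegral_enorm_sq_integral_le (L := L)
    (continuous_finsetSum _ fun j _ => hη₀.continuous_reducedKer γ j)
    (R := ∑ j ∈ I, 3 / 2 * (2 : ℝ) ^ j.1) ?_ cg sg hD.le (fun ξ => √(Real.pi * ξ / γ))
    (H γ hγ I fun j hj => le_trans (by norm_num) (hI j hj))
  · have e : ∀ x : ℝ × ℝ, ∑ j ∈ I, ∫ y : ℝ × ℝ,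
        Tker η₀ (Polynomial.C α₀ + Polynomial.C α₁ * Polynomial.X) γ j x y * f y =
        Complex.exp (Complex.I * (γ * modPhase α₀ α₁ x.1 (x.2 + α₁ / 2) : ℝ)) *
          ∫ y : ℝ × ℝ, L ((x + v).1 - y.1) (x + v).2 y.2 * g y := by
      intro x
      rw [← integral_add_right_eq_self _ v]
      simp only [hL, Finset.sum_mul]
      rw [integral_finsetSum, Finset.mul_sum]
      · refine Finset.sum_congr rfl fun j _ => ?_
        rw [← integral_const_mul]
        congr 1
        ext y
        rw [Tker_eq]
        simp only [hg, hv, add_sub_cancel_right, Prod.fst_add, Prod.snd_add, add_zero]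
        ring
      · intro j _
        have c1 : Continuous fun y : ℝ × ℝ => reducedKer η₀ γ j ((x + v).1 - y.1) (x + v).2 y.2 :=
          (hη₀.continuous_reducedKer γ j).comp
            (f := fun y : ℝ × ℝ => ((x + v).1 - y.1, (x + v).2, y.2)) (by fun_prop)
        have : Integrable
            fun y : ℝ × ℝ => reducedKer η₀ γ j ((x + v).1 - y.1) (x + v).2 y.2 * g y :=
          Continuous.integrable_of_hasCompactSupport (by fun_prop) sg.mul_left
        exact this.comp_add_right v
    have e1 : ∫⁻ y, ‖g y‖ₑ ^ 2 = ∫⁻ y, ‖f y‖ₑ ^ 2 := by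
      rw [← lintegral_add_right_eq_self _ v]
      simp only [hg, enorm_mul, norm_cexp_I_mul, one_mul, add_sub_cancel_right]
    rw [e1, ← lintegral_add_right_eq_self _ v, ← eLpNorm_two_sq volume f] at main
    rw [← ENNReal.pow_le_pow_left_iff two_ne_zero, eLpNorm_two_sq, mul_pow,
      ← ENNReal.ofReal_pow (by positivity)]
    simp only [e, enorm_mul, norm_cexp_I_mul, one_mul]
    refine main.trans (le_of_eq ?_)
    congr 2
    ring
  · intro s X Y hs
    refine Finset.sum_eq_zero fun j hj => hη₀.reducedKer_eq_zero ?_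
    exact (Finset.single_le_sum (f := fun j : ℤ × ℤ => 3 / 2 * (2 : ℝ) ^ j.1)
      (fun _ _ => by positivity) hj).trans hs.le

end
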